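/- Let A be block diagonal with q Jordan blocks J_i of sizes m_i and distinct eigenvalues λ_i ∈ [0,1), and b = (β_1^T,...,β_q^T)^T with β_i ∈ R^{m_i} having last entry b_{i,m_i}. Then vol(R_∞) = 2^n · |∏_{1≤i<j≤q} ((λ_i-λ_j)/(1-λ_iλ_j))^{m_i m_j}| · ∏_{i=1}^q |b_{i,m_i}|^{m_i} / ((1-λ_i)^{m_i}(1-λ_i^2)^{m_i(m_i-1)/2}), where n = ∑ m_i. -/

import Mathlib

open MeasureTheory

/-- Sum of `g` over strictly increasing `n`-tuples with entries in `[0, N)`. -/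
noncomputable def incSum : (n N : ℕ) → ((Fin n → ℕ) → ℝ) → ℝ
  | 0, _, g => g Fin.elim0
  | _ + 1, 0, _ => 0
  | n + 1, N + 1, g => incSum (n + 1) N (fun k => g (fun i => k i + 1)) +
      incSum n N (fun k => g (Fin.cons 0 (fun i => k i + 1)))

theorem incSum_zero (N : ℕ) (g : (Fin 0 → ℕ) → ℝ) : incSum 0 N g = g Fin.elim0 := by
  cases N <;> rfl

theorem incSum_succ_zero (n : ℕ) (g : (Fin (n+1) → ℕ) → ℝ) : incSum (n+1) 0 g = 0 := rfl

theorem incSum_succ_succ (n N : ℕ) (g : (Fin (n+1) → ℕ) → ℝ) :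
    incSum (n+1) (N+1) g = incSum (n + 1) N (fun k => g (fun i => k i + 1)) +
      incSum n N (fun k => g (Fin.cons 0 (fun i => k i + 1))) := rfl

theorem strictMono_shift {n : ℕ} {k : Fin n → ℕ} (hk : StrictMono k) :
    StrictMono (fun i => k i + 1) := fun _ _ h => Nat.succ_lt_succ (hk h)

theorem strictMono_cons {n : ℕ} {k : Fin n → ℕ} (hk : StrictMono k) :
    StrictMono (Fin.cons 0 (fun i => k i + 1) : Fin (n+1) → ℕ) := by
  intro a b h
  induction a using Fin.cases with
  | zero =>
    induction b using Fin.cases with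
    | zero => exact absurd h (lt_irrefl _)
    | succ b => simp
  | succ a =>
    induction b using Fin.cases with
    | zero => exact absurd h (Fin.not_lt_zero _)
    | succ b => simpa using hk (Fin.succ_lt_succ_iff.1 h)

theorem incSum_congr (N : ℕ) : ∀ (n : ℕ) (g g' : (Fin n → ℕ) → ℝ),
    (∀ k, StrictMono k → g k = g' k) → incSum n N g = incSum n N g' := by
  induction N with
  | zero =>
    intro n g g' h
    cases n with
    | zero => simpa [incSum_zero] using h _ (fun a => a.elim0)
    | succ n => rfl
  | succ N ih =>
    intro n g g' h
    cases n with
    | zero => simpa [incSum_zero] using h _ (fun a => a.elim0)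
    | succ n =>
      rw [incSum_succ_succ, incSum_succ_succ,
        ih _ _ _ (fun k hk => h _ (strictMono_shift hk)),
        ih _ _ _ (fun k hk => h _ (strictMono_cons hk))]

theorem incSum_mul (N : ℕ) : ∀ (n : ℕ) (c : ℝ) (g : (Fin n → ℕ) → ℝ),
    incSum n N (fun k => c * g k) = c * incSum n N g := by
  induction N with
  | zero => intro n c g; cases n <;> simp [incSum_zero, incSum_succ_zero]
  | succ N ih =>
    intro n c g
    cases n with
    | zero => simp [incSum_zero]
    | succ n =>
      rw [incSum_succ_succ, incSum_succ_succ, mul_add, ← ih, ← ih]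

theorem incSum_sum {ι : Type*} (s : Finset ι) (N : ℕ) : ∀ (n : ℕ) (g : ι → (Fin n → ℕ) → ℝ),
    incSum n N (fun k => ∑ i ∈ s, g i k) = ∑ i ∈ s, incSum n N (g i) := by
  induction N with
  | zero => intro n g; cases n <;> simp [incSum_zero, incSum_succ_zero]
  | succ N ih =>
    intro n g
    cases n with
    | zero => simp [incSum_zero]
    | succ n =>
      simp only [incSum_succ_succ]
      rw [Finset.sum_add_distrib, ← ih, ← ih]

theorem incSum_nonneg (N : ℕ) : ∀ (n : ℕ) (g : (Fin n → ℕ) → ℝ), (∀ k, 0 ≤ g k) →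
    0 ≤ incSum n N g := by
  induction N with
  | zero =>
    intro n g h
    cases n with
    | zero => exact h _
    | succ n => exact le_rfl
  | succ N ih =>
    intro n g h
    cases n with
    | zero => exact h _
    | succ n => exact add_nonneg (ih _ _ fun _ => h _) (ih _ _ fun _ => h _)

theorem incSum_continuous (N : ℕ) : ∀ (n : ℕ) (g : ℝ → (Fin n → ℕ) → ℝ),
    (∀ k, Continuous fun t => g t k) → Continuous fun t => incSum n N (g t) := by
  induction N with
  | zero =>
    intro n g h
    cases n with
    | zero => exact h _
    | succ n => exact continuous_const
  | succ N ih =>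
    intro n g h
    cases n with
    | zero => exact h _
    | succ n => exact (ih _ _ fun _ => h _).add (ih _ _ fun _ => h _)

theorem incSum_diff_step (N : ℕ) : ∀ (n : ℕ) (g h : (Fin n → ℕ) → ℝ), (∀ k, |g k| ≤ h k) →
    |incSum n (N+1) g - incSum n N g| ≤ incSum n (N+1) h - incSum n N h := by
  induction N with
  | zero =>
    intro n g h H
    cases n with
    | zero => simp [incSum_zero]
    | succ n =>
      rw [incSum_succ_succ, incSum_succ_succ]
      cases n with
      | zero => simpa [incSum_zero, incSum_succ_zero] using H _
      | succ n => simp [incSum_succ_zero]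
  | succ N ih =>
    intro n g h H
    cases n with
    | zero => simp [incSum_zero]
    | succ n =>
      have h1 := ih _ (fun k => g (fun i => k i + 1)) (fun k => h (fun i => k i + 1)) fun _ => H _
      have h2 := ih _ (fun k => g (Fin.cons 0 (fun i => k i + 1)))
        (fun k => h (Fin.cons 0 (fun i => k i + 1))) fun _ => H _
      rw [incSum_succ_succ n (N+1) g, incSum_succ_succ n (N+1) h, incSum_succ_succ n N g,
        incSum_succ_succ n N h]
      rw [abs_le] at *
      constructor <;> linarith [h1.1, h1.2, h2.1, h2.2]

theorem incSum_diff (n N M : ℕ) (g h : (Fin n → ℕ) → ℝ) (H : ∀ k, |g k| ≤ h k) :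
    |incSum n (N+M) g - incSum n N g| ≤ incSum n (N+M) h - incSum n N h := by
  induction M with
  | zero => simp
  | succ M ih =>
    have h1 := incSum_diff_step (N+M) n g h H
    rw [← add_assoc]
    rw [abs_le] at *
    constructor <;> linarith [h1.1, h1.2, ih.1, ih.2]

theorem tendsto_of_rec (a c : ℕ → ℝ) (X L : ℝ) (hX0 : 0 ≤ X) (hX : X < 1)
    (hrec : ∀ N, a (N+1) = X * a N + c N)
    (hc : Filter.Tendsto c Filter.atTop (nhds ((1 - X) * L))) :
    Filter.Tendsto a Filter.atTop (nhds L) := by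
  rw [Metric.tendsto_atTop] at *
  intro ε hε
  obtain ⟨N0, h0⟩ := hc (ε / 2 * (1 - X)) (mul_pos (half_pos hε) (by linarith))
  have key : ∀ k, |a (N0 + k) - L| ≤ X ^ k * |a N0 - L| + ε / 2 := by
    intro k
    induction k with
    | zero => simp; linarith
    | succ k ih =>
      have h1 := (h0 (N0 + k) (by omega)).le
      rw [Real.dist_eq] at h1
      rw [← add_assoc, hrec]
      have : X * a (N0 + k) + c (N0+k) - L = X * (a (N0+k) - L) + (c (N0+k) - (1-X) * L) := by ring
      rw [this]
      calc _ ≤ |X * (a (N0+k) - L)| + |(c (N0+k) - (1-X) * L)| := abs_add_le _ _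
        _ ≤ X * (X ^ k * |a N0 - L| + ε / 2) + ε / 2 * (1 - X) := by
            rw [abs_mul, abs_of_nonneg hX0]
            gcongr
        _ = _ := by ring
  have h2 : Filter.Tendsto (fun k => X ^ k * |a N0 - L|) Filter.atTop (nhds (0 * |a N0 - L|)) :=
    (tendsto_pow_atTop_nhds_zero_of_lt_one hX0 hX).mul_const _
  rw [zero_mul] at h2
  obtain ⟨K, hK⟩ := (Metric.tendsto_atTop.1 h2) (ε/2) (half_pos hε)
  refine ⟨N0 + K, fun n hn => ?_⟩
  obtain ⟨k, rfl⟩ := Nat.exists_eq_add_of_le (show N0 ≤ n by omega)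
  have h3 := hK k (by omega)
  rw [Real.dist_eq, sub_zero] at h3
  rw [Real.dist_eq]
  have := key k
  have := le_abs_self (X ^ k * |a N0 - L|)
  linarith

/-- The limit of `incSum` for the geometric weight exists. -/
theorem incSum_geom_tendsto (ρ : ℝ) (h0 : 0 ≤ ρ) (h1 : ρ < 1) (n : ℕ) :
    ∃ L, Filter.Tendsto (fun N => incSum n N (fun k => ∏ i, ρ ^ k i)) Filter.atTop (nhds L) := by
  induction n with
  | zero => exact ⟨_, by simp only [incSum_zero]; exact tendsto_const_nhds⟩
  | succ n ih =>
    obtain ⟨L, hL⟩ := ih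
    have hX : ρ ^ (n+1) < 1 := pow_lt_one₀ h0 h1 (by omega)
    have hne : 1 - ρ ^ (n+1) ≠ 0 := by linarith
    refine ⟨ρ ^ n * L / (1 - ρ ^ (n+1)), tendsto_of_rec _
      (fun N => ρ ^ n * incSum n N (fun k => ∏ i, ρ ^ k i)) (ρ ^ (n+1)) _ (by positivity) hX ?_ ?_⟩
    · intro N
      rw [incSum_succ_succ, ← incSum_mul, ← incSum_mul]
      congr 2
      · funext k
        simp [pow_succ, Finset.prod_mul_distrib]; ring
      · funext k
        rw [Fin.prod_univ_succ]
        simp [pow_succ, Finset.prod_mul_distrib]; ring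
    · rw [mul_div_cancel₀ _ hne]
      exact hL.const_mul _
/-- `krylov x k j` is the `j`-th Newton coordinate of `t ^ k` with nodes `x`. -/
noncomputable def krylov (x : ℕ → ℝ) : ℕ → ℕ → ℝ
  | 0, 0 => 1
  | 0, _ + 1 => 0
  | k + 1, 0 => x 0 * krylov x k 0
  | k + 1, j + 1 => x (j + 1) * krylov x k (j + 1) + krylov x k j

theorem krylov_zero_right (x : ℕ → ℝ) (k : ℕ) : krylov x k 0 = x 0 ^ k := by
  induction k with
  | zero => rfl
  | succ k ih => rw [krylov, ih, pow_succ]; ring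

/-- Expansion of powers in the Newton basis. -/
theorem krylov_expand {V : Type*} [AddCommGroup V] [Module ℝ V] (x : ℕ → ℝ) (f : V →ₗ[ℝ] V)
    (c : ℕ → V) (n : ℕ) (hc : ∀ j, f (c j) = c (j+1) + x j • c j) (hn : c n = 0) (k : ℕ) :
    (f ^ k) (c 0) = ∑ j ∈ Finset.range n, krylov x k j • c j := by
  have hz : ∀ k, krylov x k n • c n = 0 := by intro k; rw [hn, smul_zero]
  suffices h : (f ^ k) (c 0) = ∑ j ∈ Finset.range (n+1), krylov x k j • c j by
    rw [h, Finset.sum_range_succ, hz, add_zero]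
  induction k with
  | zero =>
    rw [Finset.sum_range_succ']
    simp [krylov]
  | succ k ih =>
    rw [pow_succ', Module.End.mul_apply, ih, map_sum]
    have h1 : ∀ j ∈ Finset.range (n+1), f (krylov x k j • c j) =
        krylov x k j • c (j+1) + (x j * krylov x k j) • c j := by
      intro j _
      rw [map_smul, hc, smul_add, smul_smul, mul_comm]
    rw [Finset.sum_congr rfl h1, Finset.sum_add_distrib]
    have h2 : ∑ j ∈ Finset.range (n+1), krylov x k j • c (j+1) =
        ∑ j ∈ Finset.range n, krylov x k j • c (j+1) := by
      rw [Finset.sum_range_succ]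
      have : c (n+1) = 0 := by
        have := hc n
        rw [hn] at this
        simpa using this.symm
      rw [this]; simp
    rw [h2, Finset.sum_range_succ' _ n, Finset.sum_range_succ' _ n]
    simp only [krylov, add_smul, Finset.sum_add_distrib]
    abel

theorem krylov_bound (x : ℕ → ℝ) (r ρ δ : ℝ) (hx0 : ∀ j, 0 ≤ x j) (hxr : ∀ j, x j ≤ r)
    (hδ : 0 < δ) (hρ : ρ = r + δ) (k j : ℕ) :
    |krylov x k j| ≤ ρ ^ k * (δ⁻¹) ^ j := by
  have hr : 0 ≤ r := (hx0 0).trans (hxr 0)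
  have hρ0 : 0 < ρ := by linarith
  induction k generalizing j with
  | zero =>
    cases j with
    | zero => simp [krylov]
    | succ j => simp [krylov]; positivity
  | succ k ih =>
    cases j with
    | zero =>
      rw [krylov, abs_mul, abs_of_nonneg (hx0 0)]
      calc _ ≤ ρ * (ρ ^ k * (δ⁻¹) ^ 0) :=
            mul_le_mul (by linarith [hxr 0]) (ih 0) (abs_nonneg _) hρ0.le
        _ = _ := by ring
    | succ j =>
      rw [krylov]
      calc _ ≤ |x (j+1) * krylov x k (j+1)| + |krylov x k j| := abs_add_le _ _
        _ ≤ r * (ρ ^ k * (δ⁻¹) ^ (j+1)) + ρ ^ k * (δ⁻¹) ^ j := by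
          rw [abs_mul, abs_of_nonneg (hx0 _)]
          exact add_le_add (mul_le_mul (hxr _) (ih _) (abs_nonneg _) hr) (ih _)
        _ = _ := by
          rw [hρ, pow_succ, pow_succ]; field_simp

theorem krylov_continuous (x : ℝ → ℕ → ℝ) (hx : ∀ j, Continuous fun t => x t j) (k j : ℕ) :
    Continuous fun t => krylov (x t) k j := by
  induction k generalizing j with
  | zero => cases j <;> exact continuous_const
  | succ k ih =>
    cases j with
    | zero => exact (hx _).mul (ih _)
    | succ j => exact ((hx _).mul (ih _)).add (ih _)

/-- The determinants of the Newton coordinates. -/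
noncomputable def kdet (x : ℕ → ℝ) (n : ℕ) (k : Fin n → ℕ) : ℝ :=
  Matrix.det (Matrix.of fun a j : Fin n => krylov x (k a) j)

theorem kdet_continuous (x : ℝ → ℕ → ℝ) (hx : ∀ j, Continuous fun t => x t j) (n : ℕ)
    (k : Fin n → ℕ) : Continuous fun t => kdet (x t) n k := by
  unfold kdet
  apply Continuous.matrix_det
  refine continuous_matrix fun i j => ?_
  exact krylov_continuous x hx _ _

theorem kdet_bound (r : ℝ) (hr : r < 1) (n : ℕ) : ∃ B ρ : ℝ, 0 ≤ ρ ∧ ρ < 1 ∧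
    ∀ x : ℕ → ℝ, (∀ j, 0 ≤ x j) → (∀ j, x j ≤ r) → ∀ k, |kdet x n k| ≤ B * ∏ i, ρ ^ k i := by
  by_cases hr0 : 0 ≤ r
  · set δ := (1 - r) / 2 with hδ
    have hδ0 : 0 < δ := by rw [hδ]; linarith
    refine ⟨∑ σ : Equiv.Perm (Fin n), ∏ i : Fin n, (δ⁻¹) ^ (i : ℕ), r + δ, by positivity,
      by rw [hδ]; linarith, ?_⟩
    intro x h0 h1 k
    unfold kdet
    rw [Matrix.det_apply, Finset.sum_mul]
    refine (Finset.abs_sum_le_sum_abs _ _).trans (Finset.sum_le_sum fun σ _ => ?_)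
    have : |Equiv.Perm.sign σ • ∏ i, (Matrix.of fun a j : Fin n => krylov x (k a) j) (σ i) i| =
      ∏ i : Fin n, |krylov x (k (σ i)) i| := by
      rcases Int.units_eq_one_or (Equiv.Perm.sign σ) with h | h <;> simp [h, Finset.abs_prod]
    rw [this, ← Equiv.prod_comp σ (fun i => (r+δ) ^ k i), ← Finset.prod_mul_distrib]
    refine Finset.prod_le_prod (fun _ _ => abs_nonneg _) fun i _ => ?_
    rw [mul_comm]
    exact krylov_bound x r _ δ h0 h1 hδ0 rfl _ _
  · exact ⟨0, 0, le_rfl, one_pos, fun x h0 h1 => absurd ((h0 0).trans (h1 0)) hr0⟩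

theorem krylov_shift (x : ℕ → ℝ) (k j : ℕ) : krylov x k (j+1) =
    ∑ l ∈ Finset.range k, x 0 ^ (k - 1 - l) * krylov (fun i => x (i+1)) l j := by
  have rec1 : ∀ j k, krylov x (k+1) (j+1) =
      x 0 * krylov x k (j+1) + krylov (fun i => x (i+1)) k j := by
    intro j k
    induction k generalizing j with
    | zero => cases j <;> simp [krylov]
    | succ k ih =>
      rw [krylov, ih j]
      cases j with
      | zero =>
        have h2 := ih 0
        rw [krylov] at h2
        rw [krylov, krylov]
        linear_combination x 0 * h2
      | succ j =>
        rw [krylov, krylov]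
        have := ih j
        have h2 := ih (j+1)
        rw [krylov] at h2
        have h3 : krylov x (k+1) (j+1) = x (j+1) * krylov x k (j+1) + krylov x k j := rfl
        linear_combination this + x 0 * h2 - h3
  induction k with
  | zero => simp [krylov]
  | succ k ih =>
    rw [rec1, ih, Finset.sum_range_succ, Finset.mul_sum]
    congr 1
    · refine Finset.sum_congr rfl fun l hl => ?_
      rw [← mul_assoc, ← pow_succ']
      congr 2
      have := Finset.mem_range.1 hl
      omega
    · simp

theorem kdet_nonneg (n : ℕ) : ∀ (x : ℕ → ℝ), (∀ j, 0 ≤ x j) → ∀ k : Fin n → ℕ, StrictMono k →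
    0 ≤ kdet x n k := by
  induction n with
  | zero => intro x hx k hk; simp [kdet]
  | succ n ih =>
    intro x hx k hk
    set y : ℕ → ℝ := fun i => x (i+1) with hy
    have hlt : ∀ a : Fin n, k a.castSucc < k a.succ := fun a => hk (Fin.castSucc_lt_succ)
    -- the rows after elimination
    let row : Fin n → Fin n → ℝ := fun a j =>
      ∑ l ∈ Finset.Ico (k a.castSucc) (k a.succ), x 0 ^ (k a.succ - 1 - l) * krylov y l j
    let B : Matrix (Fin (n+1)) (Fin (n+1)) ℝ := Matrix.of fun a j =>
      Fin.cases (motive := fun _ => ℝ) (krylov x (k 0) j)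
        (fun a' => Fin.cases (motive := fun _ => ℝ) 0 (fun j' => row a' j') j) a
    have hB : kdet x (n+1) k = B.det := by
      unfold kdet
      refine Matrix.det_eq_of_forall_row_eq_smul_add_pred
        (fun a => x 0 ^ (k a.succ - k a.castSucc)) ?_ ?_
      · intro j; rfl
      · intro a j
        induction j using Fin.cases with
        | zero =>
          simp only [Matrix.of_apply, B, Fin.val_zero, krylov_zero_right, Fin.cases_succ,
            Fin.cases_zero, zero_add]
          rw [← pow_add]
          congr 1
          have := hlt a
          omega
        | succ j =>
          simp only [Matrix.of_apply, B, Fin.val_succ, krylov_shift, Fin.cases_succ, row]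
          rw [← Finset.sum_range_add_sum_Ico _ (hlt a).le, add_comm, Finset.mul_sum]
          congr 1
          refine Finset.sum_congr rfl fun l hl => ?_
          rw [← mul_assoc, ← pow_add]
          congr 2
          have := hlt a
          have := Finset.mem_range.1 hl
          omega
    have hB2 : B.det = x 0 ^ (k 0) * (Matrix.of row).det := by
      rw [Matrix.det_succ_column_zero, Fin.sum_univ_succ]
      have : ∀ a : Fin n, B a.succ 0 = 0 := fun a => rfl
      simp only [this, mul_zero, zero_mul, Finset.sum_const_zero, add_zero]
      have h0 : B 0 0 = x 0 ^ (k 0) := krylov_zero_right _ _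
      rw [h0]
      simp only [Fin.val_zero, pow_zero, one_mul]
      congr 1
    rw [hB, hB2]
    refine mul_nonneg (pow_nonneg (hx 0) _) ?_
    have hrow : (Matrix.of row).det = Matrix.detRowAlternating.toMultilinearMap
        (fun a => ∑ l ∈ Finset.Ico (k a.castSucc) (k a.succ),
          (x 0 ^ (k a.succ - 1 - l)) • (fun j : Fin n => krylov y l j)) := by
      show Matrix.det _ = Matrix.det _
      congr 1
      ext a j
      simp [row, Finset.sum_apply]
    rw [hrow, MultilinearMap.map_sum_finset]
    refine Finset.sum_nonneg fun l hl => ?_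
    rw [MultilinearMap.map_smul_univ]
    refine smul_nonneg (Finset.prod_nonneg fun _ _ => pow_nonneg (hx 0) _) ?_
    have hl' := Fintype.mem_piFinset.1 hl
    refine ih y (fun j => hx _) l ?_
    intro a b hab
    have h1 := Finset.mem_Ico.1 (hl' a)
    have h2 := Finset.mem_Ico.1 (hl' b)
    have h3 : k a.succ ≤ k b.castSucc := hk.monotone (by
      rw [Fin.le_def]; simpa using hab)
    omega
/-- Generalized Vandermonde determinant. -/
noncomputable def gvand {n : ℕ} (x : Fin n → ℝ) (k : Fin n → ℕ) : ℝ :=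
  Matrix.det (Matrix.of fun a i : Fin n => x i ^ k a)

theorem gvand_shift {n : ℕ} (x : Fin n → ℝ) (k : Fin n → ℕ) :
    gvand x (fun i => k i + 1) = (∏ i, x i) * gvand x k := by
  unfold gvand
  rw [← Matrix.det_mul_row]
  congr 1
  ext a i
  simp [pow_succ, mul_comm]

theorem gvand_cons {n : ℕ} (x : Fin (n+1) → ℝ) (k : Fin n → ℕ) :
    gvand x (Fin.cons 0 (fun i => k i + 1)) =
      ∑ i : Fin (n+1), ((-1) ^ (i : ℕ) * ∏ j, x (i.succAbove j)) *
        gvand (fun j => x (i.succAbove j)) k := by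
  rw [gvand, Matrix.det_succ_row_zero]
  refine Finset.sum_congr rfl fun i _ => ?_
  rw [mul_assoc _ _ (gvand _ k), ← gvand_shift]
  simp only [Matrix.of_apply, Fin.cons_zero, pow_zero, mul_one]
  congr 1

/-- Product over pairs `a < b`. -/
noncomputable def pairProd {n : ℕ} (g : Fin n → Fin n → ℝ) : ℝ :=
  ∏ a, ∏ b, if a < b then g a b else 1

theorem pairProd_succAbove {n : ℕ} (g : Fin (n+1) → Fin (n+1) → ℝ) (i : Fin (n+1)) :
    pairProd g = pairProd (fun a b => g (i.succAbove a) (i.succAbove b)) *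
      ∏ j, if i < i.succAbove j then g i (i.succAbove j) else g (i.succAbove j) i := by
  unfold pairProd
  rw [Fin.prod_univ_succAbove _ i, Fin.prod_univ_succAbove _ i]
  simp only [lt_irrefl, if_false, one_mul]
  have : ∀ a : Fin n, (∏ b, if i.succAbove a < b then g (i.succAbove a) b else 1) =
      (if i.succAbove a < i then g (i.succAbove a) i else 1) *
      ∏ b, if a < b then g (i.succAbove a) (i.succAbove b) else 1 := by
    intro a
    rw [Fin.prod_univ_succAbove _ i]
    congr 1
    refine Finset.prod_congr rfl fun b _ => ?_
    simp only [Fin.succAbove_lt_succAbove_iff]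
  simp only [this]
  rw [Finset.prod_mul_distrib, ← mul_assoc, ← Finset.prod_mul_distrib, mul_comm]
  congr 1
  refine Finset.prod_congr rfl fun b _ => ?_
  rcases lt_or_gt_of_ne (Fin.succAbove_ne i b) with h | h
  · simp [h, h.not_gt]
  · simp [h, h.not_gt]

theorem prod_sign {n : ℕ} (i : Fin (n+1)) :
    ∏ j : Fin n, (if i < i.succAbove j then (1:ℝ) else -1) = (-1) ^ (i : ℕ) := by
  have h : ∀ j : Fin n, (if i < i.succAbove j then (1:ℝ) else -1) =
      if (j : ℕ) < i then -1 else 1 := by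
    intro j
    have h1 : i < i.succAbove j ↔ ¬ (j : ℕ) < i := by
      rw [Fin.lt_succAbove_iff_le_castSucc, Fin.le_def, Fin.val_castSucc, not_lt]
    by_cases h2 : (j : ℕ) < i
    · rw [if_neg (fun h => h1.1 h h2), if_pos h2]
    · rw [if_pos (h1.2 h2), if_neg h2]
  simp only [h]
  rw [Fin.prod_univ_eq_prod_range (fun j => if j < (i:ℕ) then (-1:ℝ) else 1) n,
    Finset.prod_ite]
  simp only [Finset.prod_const, one_pow, mul_one]
  congr 1
  have : (Finset.range n).filter (fun j => j < (i:ℕ)) = Finset.range i := by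
    ext j; simp; have := i.2; omega
  rw [this, Finset.card_range]

/-- The Lagrange interpolation identity. -/
theorem lagrange_identity {n : ℕ} (x : Fin (n+1) → ℝ) (hx0 : ∀ i, 0 < x i)
    (hinj : Function.Injective x) (hx1 : ∀ i, x i < 1) :
    ∑ i : Fin (n+1), (1 - x i) * ∏ j : Fin n, (x (i.succAbove j) *
      (1 - x i * x (i.succAbove j)) / (x (i.succAbove j) - x i)) = 1 - ∏ i, x i := by
  classical
  let v : Option (Option (Fin (n+1))) → ℝ := fun o => match o with
    | none => 0
    | some none => -1
    | some (some i) => x i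
  have hv : Function.Injective v := by
    intro a b h
    rcases a with _ | _ | a <;> rcases b with _ | _ | b <;> simp only [v] at h
    · rfl
    · norm_num at h
    · linarith [hx0 b]
    · norm_num at h
    · rfl
    · linarith [hx0 b]
    · linarith [hx0 a]
    · linarith [hx0 a]
    · rw [hinj h]
  let Q : Polynomial ℝ := ∏ j, (1 - Polynomial.C (x j) * Polynomial.X)
  have hQdeg : Q.natDegree ≤ n + 1 := by
    refine (Polynomial.natDegree_prod_le _ _).trans ?_
    calc _ ≤ ∑ j : Fin (n+1), 1 := Finset.sum_le_sum fun j _ => by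
          have : (1 - Polynomial.C (x j) * Polynomial.X : Polynomial ℝ) =
            Polynomial.C (-x j) * Polynomial.X + Polynomial.C 1 := by simp; ring
          rw [this]
          exact Polynomial.natDegree_linear_le
      _ = n + 1 := by simp
  have hQeval : ∀ t, Q.eval t = ∏ j, (1 - x j * t) := by
    intro t; simp [Q, Polynomial.eval_prod]
  have hcard : (Finset.univ : Finset (Option (Option (Fin (n+1))))).card = n + 3 := by simp
  have hdeg : Q.degree < ((Finset.univ : Finset (Option (Option (Fin (n+1))))).card : ℕ) := by
    rw [hcard]
    refine lt_of_le_of_lt Polynomial.degree_le_natDegree ?_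
    exact_mod_cast (by omega : Q.natDegree < n + 3)
  have key := Lagrange.coeff_eq_sum (s := Finset.univ) (v := v) hv.injOn hdeg
  rw [hcard, Polynomial.coeff_eq_zero_of_natDegree_lt (by omega)] at key
  have herase : ∀ o, ∏ j ∈ Finset.univ.erase o, (v o - v j) =
      ∏ j, if j = o then 1 else (v o - v j) := by
    intro o
    rw [← Finset.mul_prod_erase Finset.univ (fun j => if j = o then 1 else (v o - v j))
      (Finset.mem_univ o)]
    simp only [if_true, one_mul]
    refine Finset.prod_congr rfl fun j hj => ?_
    rw [if_neg (Finset.ne_of_mem_erase hj)]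
  simp only [herase, hQeval, Fintype.sum_option, Fintype.prod_option, v] at key
  simp only [reduceCtorEq, if_true, if_false, Option.some.injEq, mul_zero, sub_zero, zero_sub,
    Finset.prod_const_one, one_mul, mul_neg, mul_one, sub_neg_eq_add] at key
  have hX : 0 < ∏ i, x i := Finset.prod_pos fun i _ => hx0 i
  have hpm : ∏ j, (-1 - x j) = (-1) ^ (n+1) * ∏ j, (1 + x j) := by
    have : ∀ j, -1 - x j = (-1) * (1 + x j) := fun j => by ring
    simp only [this, Finset.prod_mul_distrib]; simp
  have hpm2 : ∏ j, (-x j) = (-1) ^ (n+1) * ∏ j, x j := by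
    have : ∀ j, - x j = (-1) * (x j) := fun j => by ring
    rw [Finset.prod_congr rfl (fun j _ => this j), Finset.prod_mul_distrib]; simp
  have hplus : ∏ j, (1 + x j) ≠ 0 := (Finset.prod_pos fun j _ => by linarith [hx0 j]).ne'
  rw [hpm, hpm2] at key
  have hterm : ∀ i : Fin (n+1), (1 - x i) * ∏ j : Fin n, (x (i.succAbove j) *
      (1 - x i * x (i.succAbove j)) / (x (i.succAbove j) - x i)) =
      (-1) ^ n * (∏ j, x j) * ((∏ j, (1 - x j * x i)) /
        (x i * ((x i + 1) * ∏ j, if j = i then 1 else x i - x j))) := by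
    intro i
    rw [Fin.prod_univ_succAbove _ i, Fin.prod_univ_succAbove _ i, Fin.prod_univ_succAbove _ i]
    simp only [if_true, Fin.succAbove_ne, if_false, one_mul]
    have e1 : ∏ j : Fin n, (x i - x (i.succAbove j)) =
        (-1) ^ n * ∏ j : Fin n, (x (i.succAbove j) - x i) := by
      have : ∀ j : Fin n, x i - x (i.succAbove j) = (-1) * (x (i.succAbove j) - x i) :=
        fun j => by ring
      simp only [this, Finset.prod_mul_distrib]; simp
    have e2 : ∏ j : Fin n, (x (i.succAbove j) - x i) ≠ 0 :=
      Finset.prod_ne_zero_iff.2 fun j _ => sub_ne_zero.2 fun h => Fin.succAbove_ne i j (hinj h)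
    have e3 : ∏ j : Fin n, (1 - x (i.succAbove j) * x i) =
        ∏ j : Fin n, (1 - x i * x (i.succAbove j)) :=
      Finset.prod_congr rfl fun j _ => by ring
    rw [e1, e3, Finset.prod_div_distrib, Finset.prod_mul_distrib]
    have := (hx0 i).ne'
    have h1 : x i + 1 ≠ 0 := by linarith [hx0 i]
    field_simp
    ring
  simp only [hterm]
  rw [← Finset.mul_sum]
  set S := ∑ i, (∏ j, (1 - x j * x i)) /
        (x i * ((x i + 1) * ∏ j, if j = i then 1 else x i - x j)) with hS
  have hs : S = -(1 / ((-1) ^ (n+1) * ∏ j, x j)) + 1 / (-1) ^ (n+1) := by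
    have h2 : (∏ j, (1 + x j)) / -((-1) ^ (n+1) * ∏ j, (1 + x j)) = - (1 / (-1) ^ (n+1)) := by
      field_simp
    rw [neg_one_mul, h2, zero_add, one_mul] at key
    linarith
  rw [hs]
  have hsq : ((-1:ℝ) ^ n) ^ 2 = 1 := by rw [← pow_mul, mul_comm, pow_mul]; simp
  rw [pow_succ]
  field_simp
  ring

/-- The closed form. -/
noncomputable def cform {n : ℕ} (x : Fin n → ℝ) : ℝ :=
  pairProd (fun a b => (x b - x a) / (1 - x a * x b)) * ∏ a, (1 - x a)⁻¹

theorem cform_rec {n : ℕ} (x : Fin (n+1) → ℝ) (hx0 : ∀ i, 0 < x i)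
    (hinj : Function.Injective x) (hx1 : ∀ i, x i < 1) :
    ∑ i : Fin (n+1), ((-1) ^ (i : ℕ) * ∏ j, x (i.succAbove j)) *
      cform (fun j => x (i.succAbove j)) = (1 - ∏ i, x i) * cform x := by
  rw [← lagrange_identity x hx0 hinj hx1, Finset.sum_mul]
  refine Finset.sum_congr rfl fun i _ => ?_
  unfold cform
  rw [pairProd_succAbove _ i, Fin.prod_univ_succAbove _ i, ← prod_sign]
  have h1 : 1 - x i ≠ 0 := by linarith [hx1 i]
  have h2 : (∏ j, if i < i.succAbove j then (x (i.succAbove j) - x i) / (1 - x i * x (i.succAbove j))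
      else (x i - x (i.succAbove j)) / (1 - x (i.succAbove j) * x i)) =
      (∏ j : Fin n, (if i < i.succAbove j then (1:ℝ) else -1)) *
      ∏ j : Fin n, ((x (i.succAbove j) - x i) / (1 - x i * x (i.succAbove j))) := by
    rw [← Finset.prod_mul_distrib]
    refine Finset.prod_congr rfl fun j _ => ?_
    split_ifs
    · ring
    · rw [mul_comm (x (i.succAbove j)) (x i)]; ring
  rw [h2]
  have h3 : (∏ j : Fin n, (x (i.succAbove j) *
      (1 - x i * x (i.succAbove j)) / (x (i.succAbove j) - x i))) *
      ∏ j : Fin n, ((x (i.succAbove j) - x i) / (1 - x i * x (i.succAbove j))) =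
      ∏ j : Fin n, x (i.succAbove j) := by
    rw [← Finset.prod_mul_distrib]
    refine Finset.prod_congr rfl fun j _ => ?_
    have e2 : x (i.succAbove j) - x i ≠ 0 := sub_ne_zero.2 fun h => Fin.succAbove_ne i j (hinj h)
    have e3 : 1 - x i * x (i.succAbove j) ≠ 0 := by
      nlinarith [hx0 i, hx1 i, hx0 (i.succAbove j), hx1 (i.succAbove j)]
    rw [div_mul_div_comm, div_eq_iff (mul_ne_zero e2 e3)]
    ring
  rw [← h3]
  have h4 : (1 - x i) * (1 - x i)⁻¹ = 1 := mul_inv_cancel₀ h1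
  generalize (∏ j : Fin n, (x (i.succAbove j) *
      (1 - x i * x (i.succAbove j)) / (x (i.succAbove j) - x i))) = A1
  generalize (∏ j : Fin n, ((x (i.succAbove j) - x i) / (1 - x i * x (i.succAbove j)))) = A2
  generalize (∏ j : Fin n, (if i < i.succAbove j then (1:ℝ) else -1)) = A3
  generalize (pairProd fun a b => (x (i.succAbove b) - x (i.succAbove a)) /
    (1 - x (i.succAbove a) * x (i.succAbove b))) = A4
  generalize (∏ a, (1 - x (i.succAbove a))⁻¹) = A5
  linear_combination (-(A1 * A2 * A3 * A4 * A5)) * h4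

theorem gvand_tendsto (n : ℕ) : ∀ (x : Fin n → ℝ), (∀ i, 0 < x i) →
    Function.Injective x → (∀ i, x i < 1) →
    Filter.Tendsto (fun N => incSum n N (gvand x)) Filter.atTop (nhds (cform x)) := by
  induction n with
  | zero =>
    intro x _ _ _
    simp only [incSum_zero]
    simp [gvand, cform, pairProd]
  | succ n ih =>
    intro x hx0 hinj hx1
    refine tendsto_of_rec _ (fun N => ∑ i : Fin (n+1), ((-1) ^ (i : ℕ) * ∏ j, x (i.succAbove j)) *
        incSum n N (gvand (fun j => x (i.succAbove j)))) (∏ i, x i) _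
        (Finset.prod_nonneg fun i _ => (hx0 i).le) ?_ ?_ ?_
    · rw [Fin.prod_univ_succ]
      have : ∏ i : Fin n, x i.succ ≤ 1 := Finset.prod_le_one (fun i _ => (hx0 _).le)
        fun i _ => (hx1 _).le
      have h1 : 0 ≤ ∏ i : Fin n, x i.succ := Finset.prod_nonneg (fun i _ => (hx0 _).le)
      nlinarith [hx0 0, hx1 0]
    · intro N
      rw [incSum_succ_succ]
      simp only [gvand_shift, gvand_cons]
      rw [incSum_mul, incSum_sum]
      simp only [incSum_mul]
    · rw [← cform_rec x hx0 hinj hx1]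
      refine tendsto_finsetSum _ fun i _ => Filter.Tendsto.const_mul _ ?_
      exact ih _ (fun _ => hx0 _) (hinj.comp Fin.succAbove_right_injective) (fun _ => hx1 _)
theorem gvand_eq (x : ℕ → ℝ) (n : ℕ) (k : Fin n → ℕ) :
    gvand (fun i : Fin n => x i) k = pairProd (fun a b : Fin n => x b - x a) * kdet x n k := by
  let Nm : Matrix (Fin n) (Fin n) ℝ :=
    Matrix.of fun j i => ∏ l ∈ Finset.range j, (x i - x l)
  have hmul : (Matrix.of fun a i : Fin n => x i ^ k a) =
      (Matrix.of fun a j : Fin n => krylov x (k a) j) * Nm := by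
    ext a i
    rw [Matrix.mul_apply]
    have h := krylov_expand x (LinearMap.mulLeft ℝ (x i))
      (fun j => ∏ l ∈ Finset.range j, (x i - x l)) n (fun j => by
        rw [LinearMap.mulLeft_apply, Finset.prod_range_succ, smul_eq_mul]; ring)
      (Finset.prod_eq_zero (Finset.mem_range.2 i.2) (sub_self _)) (k a)
    rw [LinearMap.pow_mulLeft] at h
    simp only [Finset.range_zero, Finset.prod_empty, LinearMap.mulLeft_apply, mul_one,
      smul_eq_mul] at h
    simp only [Matrix.of_apply, Nm]
    rw [h, Fin.sum_univ_eq_sum_range (fun j => krylov x (k a) j *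
      ∏ l ∈ Finset.range j, (x i - x l))]
  have hdet : Nm.det = pairProd (fun a b : Fin n => x b - x a) := by
    rw [Matrix.det_of_isUpperTriangular]
    · unfold pairProd
      rw [Finset.prod_comm]
      refine Finset.prod_congr rfl fun b _ => ?_
      simp only [Nm, Matrix.of_apply]
      have : ∀ a : Fin n, (if a < b then x b - x a else 1) =
        (fun l : ℕ => if l < (b:ℕ) then x b - x l else 1) a := fun a => rfl
      rw [Finset.prod_congr rfl (fun a _ => this a), Fin.prod_univ_eq_prod_range
        (fun l : ℕ => if l < (b:ℕ) then x b - x l else 1) n, ← Finset.prod_filter]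
      refine Finset.prod_congr ?_ fun _ _ => rfl
      ext l; simp; have := b.2; omega
    · intro i j hij
      exact Finset.prod_eq_zero (Finset.mem_range.2 hij) (sub_self _)
  rw [gvand, hmul, Matrix.det_mul, hdet, mul_comm]
  rfl

theorem pairProd_mul {n : ℕ} (g h : Fin n → Fin n → ℝ) :
    pairProd (fun a b => g a b * h a b) = pairProd g * pairProd h := by
  unfold pairProd
  rw [← Finset.prod_mul_distrib]
  refine Finset.prod_congr rfl fun a _ => ?_
  rw [← Finset.prod_mul_distrib]
  refine Finset.prod_congr rfl fun b _ => ?_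
  split_ifs <;> simp

/-- The sum of the Schur polynomials. -/
noncomputable def kform (x : ℕ → ℝ) (n : ℕ) : ℝ :=
  pairProd (fun a b : Fin n => (1 - x a * x b)⁻¹) * ∏ a : Fin n, (1 - x a)⁻¹

theorem kdet_tendsto_distinct (x : ℕ → ℝ) (n : ℕ) (hx0 : ∀ i : Fin n, 0 < x i)
    (hinj : Function.Injective fun i : Fin n => x i) (hx1 : ∀ i : Fin n, x i < 1) :
    Filter.Tendsto (fun N => incSum n N (kdet x n)) Filter.atTop (nhds (kform x n)) := by
  have h := gvand_tendsto n (fun i : Fin n => x i) hx0 hinj hx1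
  have hg : gvand (fun i : Fin n => x i) =
    fun k => pairProd (fun a b : Fin n => x b - x a) * kdet x n k := funext fun k => gvand_eq x n k
  simp only [hg, incSum_mul] at h
  have hne : pairProd (fun a b : Fin n => x b - x a) ≠ 0 := by
    refine Finset.prod_ne_zero_iff.2 fun a _ => Finset.prod_ne_zero_iff.2 fun b _ => ?_
    split_ifs with hab
    · exact sub_ne_zero.2 fun h => hab.ne' (hinj h)
    · exact one_ne_zero
  have h2 := h.const_mul (pairProd (fun a b : Fin n => x b - x a))⁻¹
  have h3 : (pairProd (fun a b : Fin n => x b - x a))⁻¹ * cform (fun i : Fin n => x i) =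
      kform x n := by
    unfold cform kform
    simp only [div_eq_mul_inv, pairProd_mul]
    field_simp
  rw [h3] at h2
  refine h2.congr fun N => ?_
  rw [inv_mul_cancel_left₀ hne]

theorem kdet_tendsto (x : ℕ → ℝ) (n : ℕ) (r : ℝ) (hr : r < 1) (hx0 : ∀ i, 0 ≤ x i)
    (hx1 : ∀ i, x i ≤ r) :
    Filter.Tendsto (fun N => incSum n N (kdet x n)) Filter.atTop (nhds (kform x n)) := by
  -- perturbation, constant for large indices
  let y : ℝ → ℕ → ℝ := fun t j => x j + t * ((min j n : ℕ) + 1)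
  have hy : ∀ j, Continuous fun t => y t j := fun j => by fun_prop
  have hy0 : y 0 = x := by funext j; simp [y]
  set r' := (1 + r) / 2 with hr'
  have hr'1 : r' < 1 := by rw [hr']; linarith
  obtain ⟨B, ρ, hρ0, hρ1, hB⟩ := kdet_bound r' hr'1 n
  obtain ⟨L, hL⟩ := incSum_geom_tendsto ρ hρ0 hρ1 n
  -- small positive parameters
  have ht : ∀ᶠ t in nhdsWithin (0:ℝ) (Set.Ioi 0), 0 < t ∧ t * (n + 1) ≤ r' - r := by
    refine Filter.Eventually.and self_mem_nhdsWithin ?_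
    refine nhdsWithin_le_nhds ?_
    have hc : Continuous fun t : ℝ => t * (n + 1) := by fun_prop
    refine (hc.tendsto 0).eventually_le_const ?_
    rw [zero_mul, hr']; linarith
  have hdist : ∀ᶠ t in nhdsWithin (0:ℝ) (Set.Ioi 0),
      Function.Injective fun i : Fin n => y t i := by
    have : ∀ᶠ t in nhdsWithin (0:ℝ) (Set.Ioi 0), ∀ p : Fin n × Fin n, p.1 ≠ p.2 →
        y t p.1 ≠ y t p.2 := by
      rw [Filter.eventually_all]
      rintro ⟨a, b⟩
      by_cases hab : a = b
      · exact Filter.Eventually.of_forall fun t h => absurd hab h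
      by_cases hx : x a = x b
      · filter_upwards [self_mem_nhdsWithin] with t ht _ h
        have ht' : (0:ℝ) < t := ht
        simp only [y, hx, min_eq_left a.2.le, min_eq_left b.2.le] at h
        have h2 := mul_left_cancel₀ ht'.ne' (add_left_cancel h)
        exact hab (Fin.ext (by exact_mod_cast add_right_cancel h2))
      · have h1 : y 0 a ≠ y 0 b := by rw [hy0]; exact hx
        have := ((hy a).sub (hy b)).tendsto 0
        have h2 := this.eventually_ne (sub_ne_zero.2 h1)
        filter_upwards [nhdsWithin_le_nhds h2] with t h3 _
        exact sub_ne_zero.1 h3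
    filter_upwards [this] with t h a b hab
    by_contra hne
    exact h (a, b) hne hab
  -- uniform estimate
  have key : ∀ᶠ t in nhdsWithin (0:ℝ) (Set.Ioi 0), ∀ N,
      |kform (y t) n - incSum n N (kdet (y t) n)| ≤
        B * L - B * incSum n N (fun k => ∏ i, ρ ^ k i) := by
    filter_upwards [ht, hdist] with t ⟨ht0, ht1⟩ hinj N
    have hmin : ∀ j : ℕ, (((min j n : ℕ) : ℝ)) ≤ n := fun j => by exact_mod_cast min_le_right _ _
    have p0 : ∀ j, 0 < y t j := fun j => by
      have : 0 < t * ((min j n : ℕ) + 1 : ℝ) := by positivity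
      have := hx0 j
      simp only [y]; linarith
    have p1 : ∀ j, y t j ≤ r' := fun j => by
      have : t * ((min j n : ℕ) + 1 : ℝ) ≤ t * (n + 1) := by
        have := hmin j
        gcongr
      have := hx1 j
      simp only [y]; linarith
    have hbd := hB (y t) (fun j => (p0 j).le) p1
    have hlim := kdet_tendsto_distinct (y t) n (fun i => p0 i) hinj
      (fun i => (p1 i).trans_lt hr'1)
    have hd : ∀ M, |incSum n (N+M) (kdet (y t) n) - incSum n N (kdet (y t) n)| ≤
        B * incSum n (N+M) (fun k => ∏ i, ρ ^ k i) - B * incSum n N (fun k => ∏ i, ρ ^ k i) := by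
      intro M
      rw [← incSum_mul, ← incSum_mul]
      exact incSum_diff n N M _ _ hbd
    have hshift : Filter.Tendsto (fun M : ℕ => N + M) Filter.atTop Filter.atTop :=
      Filter.tendsto_atTop_mono (fun M => Nat.le_add_left M N) Filter.tendsto_id
    exact le_of_tendsto_of_tendsto ((hlim.comp hshift).sub_const _).abs
      (((hL.comp hshift).const_mul B).sub_const _) (Filter.Eventually.of_forall hd)
  have hkf : Filter.Tendsto (fun t => kform (y t) n) (nhds 0) (nhds (kform (y 0) n)) := by
    have hlt : ∀ i, x i < 1 := fun i => (hx1 i).trans_lt hr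
    unfold kform pairProd
    refine Filter.Tendsto.mul ?_ ?_
    · refine tendsto_finsetProd _ fun a _ => tendsto_finsetProd _ fun b _ => ?_
      split_ifs
      · refine Filter.Tendsto.inv₀ ((continuous_const.sub ((hy _).mul (hy _))).tendsto 0) ?_
        rw [hy0]
        nlinarith [hx0 a, hx0 b, hlt a, hlt b]
      · exact tendsto_const_nhds
    · refine tendsto_finsetProd _ fun a _ => ?_
      refine Filter.Tendsto.inv₀ ((continuous_const.sub (hy _)).tendsto 0) ?_
      rw [hy0]
      linarith [hlt a]
  have key2 : ∀ N, |kform x n - incSum n N (kdet x n)| ≤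
        B * L - B * incSum n N (fun k => ∏ i, ρ ^ k i) := by
    intro N
    have h1 : Filter.Tendsto (fun t => |kform (y t) n - incSum n N (kdet (y t) n)|)
        (nhds 0) (nhds |kform (y 0) n - incSum n N (kdet (y 0) n)|) :=
      (hkf.sub ((incSum_continuous N n (fun t => kdet (y t) n)
        (fun k => kdet_continuous y hy n k)).tendsto 0)).abs
    rw [hy0] at h1
    have h2 : Filter.Tendsto (fun t => |kform (y t) n - incSum n N (kdet (y t) n)|)
        (nhdsWithin (0:ℝ) (Set.Ioi 0)) (nhds |kform x n - incSum n N (kdet x n)|) :=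
      h1.mono_left nhdsWithin_le_nhds
    refine le_of_tendsto h2 ?_
    filter_upwards [key] with t h using h N
  have h0 : Filter.Tendsto (fun N => B * L - B * incSum n N (fun k => ∏ i, ρ ^ k i)) Filter.atTop
      (nhds 0) := by
    have := (hL.const_mul B).const_sub (B * L)
    rwa [sub_self] at this
  rw [tendsto_iff_dist_tendsto_zero]
  refine squeeze_zero (fun _ => dist_nonneg) (fun N => ?_) h0
  rw [dist_comm, Real.dist_eq]
  exact key2 N
/-- Finite zonotope. -/
def zono {n : ℕ} (v : ℕ → Fin n → ℝ) (N : ℕ) : Set (Fin n → ℝ) :=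
  {x | ∃ u : ℕ → ℝ, (∀ k, |u k| ≤ 1) ∧ ∑ k ∈ Finset.range N, u k • v k = x}

theorem zono_eq_image {n : ℕ} (v : ℕ → Fin n → ℝ) (N : ℕ) :
    zono v N = (fun u : ℕ → ℝ => ∑ k ∈ Finset.range N, u k • v k) ''
      (Set.univ.pi fun _ => Set.Icc (-1) 1) := by
  ext x
  simp only [zono, Set.mem_ofPred_eq, Set.mem_image, Set.mem_pi, Set.mem_univ, true_imp_iff,
    Set.mem_Icc, abs_le]

theorem zono_convex {n : ℕ} (v : ℕ → Fin n → ℝ) (N : ℕ) : Convex ℝ (zono v N) := by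
  rintro _ ⟨u, hu, rfl⟩ _ ⟨w, hw, rfl⟩ p q hp hq hpq
  refine ⟨fun k => p * u k + q * w k, fun k => ?_, ?_⟩
  · have h1 := abs_le.1 (hu k)
    have h2 := abs_le.1 (hw k)
    exact abs_le.2 ⟨by nlinarith [h1.1, h2.1], by nlinarith [h1.2, h2.2]⟩
  · simp only [add_smul, Finset.sum_add_distrib, Finset.smul_sum, smul_smul]

theorem zono_compact {n : ℕ} (v : ℕ → Fin n → ℝ) (N : ℕ) : IsCompact (zono v N) := by
  rw [zono_eq_image]
  exact (isCompact_univ_pi fun _ => isCompact_Icc).image (by fun_prop)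

theorem zono_zero {n : ℕ} (v : ℕ → Fin n → ℝ) : zono v 0 = {0} := by
  ext x
  simp only [zono, Finset.range_zero, Finset.sum_empty, Set.mem_ofPred_eq, Set.mem_singleton_iff]
  exact ⟨fun ⟨_, _, h⟩ => h.symm, fun h => ⟨0, by simp, h.symm⟩⟩

/-- Adding a segment. -/
def addSeg {n : ℕ} (K : Set (Fin n → ℝ)) (w : Fin n → ℝ) : Set (Fin n → ℝ) :=
  (fun p : (Fin n → ℝ) × ℝ => p.1 + p.2 • w) '' (K ×ˢ Set.Icc (-1) 1)

theorem zono_succ {n : ℕ} (v : ℕ → Fin n → ℝ) (N : ℕ) :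
    zono v (N+1) = addSeg (zono (fun k => v (k+1)) N) (v 0) := by
  ext x
  simp only [zono, addSeg, Set.mem_ofPred_eq, Set.mem_image, Set.mem_prod, Prod.exists]
  constructor
  · rintro ⟨u, hu, rfl⟩
    exact ⟨_, u 0, ⟨⟨fun k => u (k+1), fun k => hu _, rfl⟩, abs_le.1 (hu 0)⟩,
      (Finset.sum_range_succ' (fun k => u k • v k) N).symm⟩
  · rintro ⟨z, s, ⟨⟨u, hu, rfl⟩, hs⟩, rfl⟩
    refine ⟨fun k => Nat.casesOn k s u, fun k => ?_, ?_⟩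
    · cases k with
      | zero => exact abs_le.2 hs
      | succ k => exact hu k
    · rw [Finset.sum_range_succ']
      rfl

theorem addSeg_compact {n : ℕ} {K : Set (Fin n → ℝ)} (hK : IsCompact K) (w : Fin n → ℝ) :
    IsCompact (addSeg K w) :=
  (hK.prod isCompact_Icc).image (by fun_prop)

theorem zono_image {n m : ℕ} (v : ℕ → Fin n → ℝ) (N : ℕ) (f : (Fin n → ℝ) →ₗ[ℝ] (Fin m → ℝ)) :
    f '' zono v N = zono (fun k => f (v k)) N := by
  ext x
  simp only [zono, Set.mem_image, Set.mem_ofPred_eq]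
  constructor
  · rintro ⟨_, ⟨u, hu, rfl⟩, rfl⟩
    exact ⟨u, hu, by simp⟩
  · rintro ⟨u, hu, rfl⟩
    exact ⟨_, ⟨u, hu, rfl⟩, by simp⟩

/-- The tail projection. -/
def tailMap (n : ℕ) : (Fin (n+1) → ℝ) →ₗ[ℝ] (Fin n → ℝ) := LinearMap.funLeft ℝ ℝ Fin.succ

theorem volume_fiber {n : ℕ} {S : Set (Fin (n+1) → ℝ)} (hS : MeasurableSet S) :
    volume S = ∫⁻ y : Fin n → ℝ, volume {t : ℝ | (Fin.cons t y : Fin (n+1) → ℝ) ∈ S} := by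
  have h := (volume_preserving_piFinSuccAbove (fun _ : Fin (n+1) => ℝ) 0).symm
  rw [← h.measure_preimage hS.nullMeasurableSet, Measure.volume_eq_prod,
    Measure.prod_apply_symm ((MeasurableEquiv.measurable _) hS)]
  refine lintegral_congr fun y => ?_
  congr 1
  ext t
  simp [MeasurableEquiv.piFinSuccAbove, Fin.insertNthEquiv]

theorem volume_addSeg {n : ℕ} {K : Set (Fin (n+1) → ℝ)} (hK : IsCompact K) (hc : Convex ℝ K) :
    volume (addSeg K (Pi.single 0 1)) = volume K + 2 * volume (tailMap n '' K) := by
  have htail : IsCompact (tailMap n '' K) :=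
    hK.image (LinearMap.continuous_of_finiteDimensional _)
  rw [volume_fiber (addSeg_compact hK _).measurableSet, volume_fiber hK.measurableSet]
  have hind : 2 * volume (tailMap n '' K) =
      ∫⁻ y, (tailMap n '' K).indicator (fun _ => (2:ENNReal)) y := by
    rw [lintegral_indicator htail.measurableSet, lintegral_const, Measure.restrict_apply_univ]
  rw [hind, ← lintegral_add_right _ (measurable_const.indicator htail.measurableSet)]
  refine lintegral_congr fun y => ?_
  have hmem : ∀ t, (Fin.cons t y : Fin (n+1) → ℝ) ∈ addSeg K (Pi.single 0 1) ↔
      ∃ s ∈ Set.Icc (-1:ℝ) 1, (Fin.cons (t - s) y : Fin (n+1) → ℝ) ∈ K := by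
    intro t
    have hcons : ∀ (a s : ℝ), (Fin.cons a y : Fin (n+1) → ℝ) + s • Pi.single 0 1 =
        Fin.cons (a + s) y := by
      intro a s
      funext i
      induction i using Fin.cases with
      | zero => simp
      | succ i => simp
    constructor
    · rintro ⟨⟨z, s⟩, ⟨hz, hs⟩, h⟩
      refine ⟨s, hs, ?_⟩
      have : (Fin.cons (t - s) y : Fin (n+1) → ℝ) = z := by
        have h1 : z = Fin.cons t y + (-s) • (Pi.single 0 1 : Fin (n+1) → ℝ) := by
          rw [← h]; simp
        rw [h1, hcons, sub_eq_add_neg]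
      rw [this]; exact hz
    · rintro ⟨s, hs, h⟩
      refine ⟨⟨Fin.cons (t - s) y, s⟩, ⟨h, hs⟩, ?_⟩
      show (Fin.cons (t - s) y : Fin (n+1) → ℝ) + s • _ = _
      rw [hcons, sub_add_cancel]
  have htl : y ∈ tailMap n '' K ↔ {t : ℝ | (Fin.cons t y : Fin (n+1) → ℝ) ∈ K}.Nonempty := by
    constructor
    · rintro ⟨z, hz, rfl⟩
      refine ⟨z 0, ?_⟩
      have : (Fin.cons (z 0) (tailMap n z) : Fin (n+1) → ℝ) = z := Fin.cons_self_tail z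
      rw [Set.mem_ofPred_eq, this]; exact hz
    · rintro ⟨t, ht⟩
      exact ⟨_, ht, by funext i; simp [tailMap, LinearMap.funLeft]⟩
  by_cases hne : y ∈ tailMap n '' K
  · rw [Set.indicator_of_mem hne]
    have hne' := htl.1 hne
    set F := {t : ℝ | (Fin.cons t y : Fin (n+1) → ℝ) ∈ K} with hF
    have hcts : Continuous fun t : ℝ => (Fin.cons t y : Fin (n+1) → ℝ) := by
      refine continuous_pi fun i => ?_
      induction i using Fin.cases with
      | zero => exact continuous_id
      | succ i => exact continuous_const
    have hFclosed : IsClosed F := hK.isClosed.preimage hcts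
    have hFcomp : IsCompact F := by
      have himg : IsCompact ((fun z : Fin (n+1) → ℝ => z 0) '' K) :=
        hK.image (continuous_apply 0)
      refine himg.of_isClosed_subset hFclosed ?_
      intro t ht
      exact ⟨_, ht, rfl⟩
    have hFconv : Convex ℝ F := by
      intro a ha b hb p q hp hq hpq
      have := hc ha hb hp hq hpq
      have he : p • (Fin.cons a y : Fin (n+1) → ℝ) + q • (Fin.cons b y : Fin (n+1) → ℝ) =
          Fin.cons (p • a + q • b) y := by
        funext i
        induction i using Fin.cases with
        | zero => simp
        | succ i => simp [← add_mul, hpq]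
      rw [he] at this
      exact this
    have hIcc := eq_Icc_of_connected_compact ⟨hne', hFconv.isPreconnected⟩ hFcomp
    set a := sInf F
    set b := sSup F
    have hab : a ≤ b := by rw [hIcc] at hne'; exact Set.nonempty_Icc.1 hne'
    have hset : {t : ℝ | (Fin.cons t y : Fin (n+1) → ℝ) ∈ addSeg K (Pi.single 0 1)} =
        Set.Icc (a-1) (b+1) := by
      ext t
      rw [Set.mem_ofPred_eq, hmem]
      have : ∀ s, (Fin.cons s y : Fin (n+1) → ℝ) ∈ K ↔ s ∈ Set.Icc a b := by
        intro s; rw [← hIcc]; rfl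
      simp only [this, Set.mem_Icc]
      constructor
      · rintro ⟨s, hs, h⟩; constructor <;> linarith [hs.1, hs.2, h.1, h.2]
      · rintro ⟨h1, h2⟩
        by_cases h3 : t < a
        · exact ⟨t - a, ⟨by linarith, by linarith⟩, by linarith, by linarith⟩
        · by_cases h4 : b < t
          · exact ⟨t - b, ⟨by linarith, by linarith⟩, by linarith, by linarith⟩
          · exact ⟨0, ⟨by linarith, by linarith⟩, by linarith, by linarith⟩
    rw [hset, hIcc, Real.volume_Icc, Real.volume_Icc]
    rw [show b + 1 - (a - 1) = (b - a) + 2 by ring, ENNReal.ofReal_add (by linarith) (by norm_num)]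
    simp
  · rw [Set.indicator_of_notMem hne, add_zero]
    rw [htl, Set.not_nonempty_iff_eq_empty] at hne
    rw [hne]
    have : {t : ℝ | (Fin.cons t y : Fin (n+1) → ℝ) ∈ addSeg K (Pi.single 0 1)} = ∅ := by
      ext t
      rw [Set.mem_ofPred_eq, hmem]
      simp only [Set.mem_empty_iff_false, iff_false]
      rintro ⟨s, _, h⟩
      exact (Set.ext_iff.1 hne (t - s)).1 h
    rw [this]

theorem det_linear {n : ℕ} (f : (Fin n → ℝ) →ₗ[ℝ] (Fin n → ℝ)) (w : Fin n → Fin n → ℝ) :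
    Matrix.det (Matrix.of fun a => f (w a)) = LinearMap.det f * Matrix.det (Matrix.of w) := by
  rw [← LinearMap.det_toMatrix', mul_comm, ← Matrix.det_transpose (LinearMap.toMatrix' f),
    ← Matrix.det_mul]
  congr 1
  ext a i
  rw [Matrix.mul_apply]
  have : f (w a) = (LinearMap.toMatrix' f).mulVec (w a) := by
    rw [← Matrix.toLin'_apply, Matrix.toLin'_toMatrix']
  simp [this, Matrix.mulVec, dotProduct, mul_comm]

theorem incSum_zero_fun (n N : ℕ) : incSum n N (fun _ => 0) = 0 := by
  have := incSum_mul N n 0 (fun _ => 0)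
  simpa using this

theorem volume_zono (N : ℕ) : ∀ (n : ℕ) (v : ℕ → Fin n → ℝ), volume (zono v N) =
    ENNReal.ofReal (2 ^ n * incSum n N (fun k => |Matrix.det (Matrix.of fun a => v (k a))|)) := by
  have hzero : ∀ (N : ℕ) (v : ℕ → Fin 0 → ℝ), volume (zono v N) = 1 := by
    intro N v
    have : zono v N = Set.univ := by
      ext x
      simp only [Set.mem_univ, iff_true]
      exact ⟨0, by simp, Subsingleton.elim _ _⟩
    rw [this, volume_pi]
    simp
  induction N with
  | zero =>
    intro n v
    cases n with
    | zero => rw [hzero]; simp [incSum_zero]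
    | succ n => rw [zono_zero, incSum_succ_zero]; simp
  | succ N ih =>
    intro n v
    cases n with
    | zero => rw [hzero]; simp [incSum_zero]
    | succ n =>
      -- the normalized case
      have main : ∀ v : ℕ → Fin (n+1) → ℝ, v 0 = Pi.single 0 1 → volume (zono v (N+1)) =
          ENNReal.ofReal (2 ^ (n+1) * incSum (n+1) (N+1)
            (fun k => |Matrix.det (Matrix.of fun a => v (k a))|)) := by
        intro v hv
        rw [zono_succ, hv, volume_addSeg (zono_compact _ _) (zono_convex _ _), zono_image, ih, ih,
          incSum_succ_succ]
        have h2 : (2:ENNReal) = ENNReal.ofReal 2 := by simp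
        rw [h2, ← ENNReal.ofReal_mul (by norm_num), ← ENNReal.ofReal_add]
        · congr 1
          rw [mul_add]
          congr 1
          rw [pow_succ']
          rw [mul_assoc]
          congr 3
          funext k
          rw [Matrix.det_succ_row_zero, Fin.sum_univ_succ]
          have hz : ∀ j : Fin n, (Matrix.of fun a => v ((Fin.cons 0 fun i => k i + 1 :
              Fin (n+1) → ℕ) a)) 0 j.succ = 0 := by
            intro j
            simp [hv]
          have h1 : (Matrix.of fun a => v ((Fin.cons 0 fun i => k i + 1 :
              Fin (n+1) → ℕ) a)) 0 0 = 1 := by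
            simp [hv]
          simp only [hz, h1, mul_zero, zero_mul, Finset.sum_const_zero, add_zero, Fin.val_zero,
            pow_zero, one_mul]
          congr 1
        · exact mul_nonneg (by positivity) (incSum_nonneg _ _ _ fun _ => abs_nonneg _)
        · exact mul_nonneg (by positivity) (mul_nonneg (by positivity)
            (incSum_nonneg _ _ _ fun _ => abs_nonneg _))
      by_cases hv : v 0 = 0
      · have h1 : zono v (N+1) = zono (fun k => v (k+1)) N := by
          rw [zono_succ, hv]
          ext x
          simp only [addSeg, smul_zero, add_zero, Set.mem_image, Set.mem_prod, Prod.exists]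
          constructor
          · rintro ⟨z, s, ⟨hz, _⟩, rfl⟩; exact hz
          · intro h; exact ⟨x, 0, ⟨h, by simp⟩, rfl⟩
        rw [h1, ih, incSum_succ_succ]
        have h2 : ∀ k : Fin n → ℕ, |Matrix.det (Matrix.of fun a => v ((Fin.cons 0 fun i => k i + 1 :
              Fin (n+1) → ℕ) a))| = 0 := by
          intro k
          rw [abs_eq_zero]
          exact Matrix.det_eq_zero_of_row_eq_zero 0 fun j => by simp [hv]
        simp only [h2, incSum_zero_fun, add_zero]
      · obtain ⟨L, hL⟩ := SeparatingDual.exists_continuousLinearEquiv_apply_eq (R := ℝ)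
          (x := v 0) (y := Pi.single 0 1) hv (by simp)
        let f : (Fin (n+1) → ℝ) →ₗ[ℝ] (Fin (n+1) → ℝ) := L.toLinearEquiv.toLinearMap
        have hf : ∀ z, f z = L z := fun z => rfl
        have hdet : LinearMap.det f ≠ 0 := (LinearEquiv.isUnit_det' L.toLinearEquiv).ne_zero
        have h := main (fun k => f (v k)) hL
        rw [← zono_image, Measure.addHaar_image_linearMap] at h
        simp only [det_linear, abs_mul, incSum_mul] at h
        rw [mul_left_comm, ENNReal.ofReal_mul (abs_nonneg _)] at h
        refine (ENNReal.mul_right_inj ?_ ENNReal.ofReal_ne_top).1 h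
        simpa using hdet

theorem volume_reach {n : ℕ} (v : ℕ → Fin n → ℝ) (C : ℝ)
    (hC : Filter.Tendsto (fun N => incSum n N (fun k => |Matrix.det (Matrix.of fun a => v (k a))|))
      Filter.atTop (nhds C)) :
    volume {x : Fin n → ℝ | ∃ u : ℕ → ℝ, (∀ k, |u k| ≤ 1) ∧ HasSum (fun k => u k • v k) x} =
      ENNReal.ofReal (2 ^ n * C) := by
  set R := {x : Fin n → ℝ | ∃ u : ℕ → ℝ, (∀ k, |u k| ≤ 1) ∧ HasSum (fun k => u k • v k) x} with hR
  have hmono : Monotone (zono v) := by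
    refine monotone_nat_of_le_succ fun N => ?_
    rintro x ⟨u, hu, rfl⟩
    refine ⟨fun k => if k < N then u k else 0, fun k => ?_, ?_⟩
    · by_cases hk : k < N
      · simpa [hk] using hu k
      · simp [hk]
    · rw [Finset.sum_range_succ]
      simp only [lt_irrefl, if_false, zero_smul, add_zero]
      refine Finset.sum_congr rfl fun k hk => ?_
      rw [if_pos (Finset.mem_range.1 hk)]
  set U := ⋃ N, zono v N with hU
  have hUconv : Convex ℝ U := hmono.directed_le.convex_iUnion fun N => zono_convex v N
  have h1 : U ⊆ R := by
    intro x hx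
    obtain ⟨N, u, hu, rfl⟩ := Set.mem_iUnion.1 hx
    refine ⟨fun k => if k < N then u k else 0, fun k => ?_, ?_⟩
    · by_cases hk : k < N
      · simpa [hk] using hu k
      · simp [hk]
    · have : ∑ k ∈ Finset.range N, u k • v k =
          ∑ k ∈ Finset.range N, (if k < N then u k else 0) • v k :=
        Finset.sum_congr rfl fun k hk => by rw [if_pos (Finset.mem_range.1 hk)]
      rw [this]
      refine hasSum_sum_of_ne_finset_zero fun k hk => ?_
      have : ¬ k < N := fun h => hk (Finset.mem_range.2 h)
      simp [this]
  have h2 : R ⊆ closure U := by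
    rintro x ⟨u, hu, hx⟩
    refine mem_closure_of_tendsto hx.tendsto_sum_nat (Filter.Eventually.of_forall fun N => ?_)
    exact Set.mem_iUnion.2 ⟨N, u, hu, rfl⟩
  have h3 : volume (closure U) = volume U := by
    refine le_antisymm ?_ (measure_mono subset_closure)
    calc volume (closure U) ≤ volume (U ∪ frontier U) := measure_mono (by
          rw [closure_eq_self_union_frontier])
      _ ≤ volume U + volume (frontier U) := measure_union_le _ _
      _ = volume U := by rw [hUconv.addHaar_frontier volume, add_zero]
  have h4 : volume R = volume U :=
    le_antisymm ((measure_mono h2).trans h3.le) (measure_mono h1)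
  rw [h4]
  have h5 := tendsto_measure_iUnion_atTop (μ := volume) hmono
  refine tendsto_nhds_unique h5 ?_
  have : (volume ∘ zono v) = fun N => ENNReal.ofReal (2 ^ n * incSum n N
      (fun k => |Matrix.det (Matrix.of fun a => v (k a))|)) := funext fun N => volume_zono N n v
  rw [this]
  exact ENNReal.tendsto_ofReal (hC.const_mul _)

/-- Lexicographic enumeration of the sigma type. -/
theorem exists_enum (q : ℕ) (m : Fin q → ℕ) :
    ∃ o : Fin (∑ i, m i) ≃ ((i : Fin q) × Fin (m i)), ∀ a b, a < b ↔
      ((o a).1 < (o b).1 ∨ ((o a).1 = (o b).1 ∧ ((o a).2 : ℕ) < (o b).2)) := by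
  classical
  have hcard : Fintype.card (Lex ((i : Fin q) × Fin (m i))) = ∑ i, m i := by
    have : Fintype.card (Lex ((i : Fin q) × Fin (m i))) =
      Fintype.card ((i : Fin q) × Fin (m i)) := Fintype.card_congr ofLex
    rw [this]; simp
  let o := Fintype.orderIsoFinOfCardEq (Lex ((i : Fin q) × Fin (m i))) hcard
  refine ⟨o.toEquiv.trans ofLex, fun a b => ?_⟩
  rw [← o.lt_iff_lt, Sigma.Lex.lt_def]
  have key : ∀ s t : (i : Fin q) × Fin (m i),
      (s.1 < t.1 ∨ ∃ h : s.1 = t.1, h.rec s.2 < t.2) ↔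
      (s.1 < t.1 ∨ (s.1 = t.1 ∧ (s.2 : ℕ) < t.2)) := by
    rintro ⟨i, r⟩ ⟨j, s⟩
    refine or_congr Iff.rfl ⟨?_, ?_⟩
    · rintro ⟨h, h'⟩
      dsimp at h
      subst h
      exact ⟨rfl, h'⟩
    · rintro ⟨h, h'⟩
      dsimp at h
      subst h
      exact ⟨rfl, h'⟩
  exact key (o a) (o b)

/-- Evolution of one Jordan block under successive shifted multiplications. -/
theorem block_rec (y : ℕ → ℝ) (m : ℕ) (c : ℕ → ℕ → ℝ) (h0 : ∀ r, m ≤ r → c 0 r = 0)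
    (hc : ∀ j r, c (j+1) r = y j * c j r + c j (r+1)) (j : ℕ) :
    (∀ r, m ≤ r + ((Finset.range j).filter (fun l => y l = 0)).card → c j r = 0) ∧
    (∀ r, r + ((Finset.range j).filter (fun l => y l = 0)).card + 1 = m →
      c j r = c 0 (m-1) * ∏ l ∈ Finset.range j, if y l = 0 then 1 else y l) := by
  induction j with
  | zero =>
    refine ⟨fun r hr => h0 r (by simpa using hr), fun r hr => ?_⟩
    have : m - 1 = r := by simp at hr; omega
    simp [this]
  | succ j ih =>
    obtain ⟨ih1, ih2⟩ := ih
    rw [Finset.range_add_one, Finset.filter_insert, Finset.prod_insert (by simp)]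
    by_cases hy : y j = 0
    · rw [if_pos hy, if_pos hy, Finset.card_insert_of_notMem (by simp)]
      refine ⟨fun r hr => ?_, fun r hr => ?_⟩
      · rw [hc, hy, ih1 (r+1) (by omega)]; simp
      · rw [hc, hy, ih2 (r+1) (by omega)]; simp
    · rw [if_neg hy, if_neg hy]
      refine ⟨fun r hr => ?_, fun r hr => ?_⟩
      · rw [hc, ih1 r hr, ih1 (r+1) (by omega)]; simp
      · rw [hc, ih2 r hr, ih1 (r+1) (by omega)]; ring

theorem pairs_same (m : ℕ) (g : ℝ) :
    (∏ r : Fin m, ∏ s : Fin m, if (r : ℕ) < s then g else 1) = g ^ (m * (m-1) / 2) := by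
  rw [Finset.prod_comm]
  have : ∀ s : Fin m, (∏ r : Fin m, if (r : ℕ) < s then g else 1) = g ^ (s : ℕ) := by
    intro s
    rw [Fin.prod_univ_eq_prod_range (fun r => if r < (s:ℕ) then g else 1) m,
      ← Finset.prod_filter, Finset.prod_const]
    congr 1
    have : (Finset.range m).filter (fun r => r < (s : ℕ)) = Finset.range s := by
      ext r; simp; omega
    rw [this, Finset.card_range]
  rw [Finset.prod_congr rfl (fun s _ => this s),
    Fin.prod_univ_eq_prod_range (fun s => g ^ s) m, Finset.prod_pow_eq_pow_sum,
    Finset.sum_range_id]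

theorem pairs_lex (q : ℕ) (m : Fin q → ℕ) (G : Fin q → Fin q → ℝ)
    (o : Fin (∑ i, m i) ≃ ((i : Fin q) × Fin (m i)))
    (ho : ∀ a b, a < b ↔
      ((o a).1 < (o b).1 ∨ ((o a).1 = (o b).1 ∧ ((o a).2 : ℕ) < (o b).2))) :
    pairProd (fun a b => G (o a).1 (o b).1) =
      (∏ i, ∏ j, if i < j then (G i j) ^ (m i * m j) else 1) *
        ∏ i, (G i i) ^ (m i * (m i - 1) / 2) := by
  classical
  have h1 : pairProd (fun a b => G (o a).1 (o b).1) =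
      ∏ p : (i : Fin q) × Fin (m i), ∏ p' : (i : Fin q) × Fin (m i),
        if (p.1 < p'.1 ∨ (p.1 = p'.1 ∧ (p.2 : ℕ) < p'.2)) then G p.1 p'.1 else 1 := by
    unfold pairProd
    rw [← Equiv.prod_comp o]
    refine Finset.prod_congr rfl fun a _ => ?_
    rw [← Equiv.prod_comp o]
    refine Finset.prod_congr rfl fun b _ => ?_
    simp only [ho]
  rw [h1, Fintype.prod_sigma]
  simp only [Fintype.prod_sigma]
  rw [← Finset.prod_mul_distrib]
  refine Finset.prod_congr rfl fun i _ => ?_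
  rw [Finset.prod_comm]
  have hj : ∀ j, (∏ r : Fin (m i), ∏ s : Fin (m j),
      if (i < j ∨ (i = j ∧ (r : ℕ) < s)) then G i j else 1) =
      (if i < j then (G i j) ^ (m i * m j) else 1) *
        (if i = j then (G i j) ^ (m i * (m i - 1) / 2) else 1) := by
    intro j
    rcases lt_trichotomy i j with h | h | h
    · simp [h, h.ne, ← pow_mul, mul_comm]
    · subst h
      simpa using pairs_same (m i) (G i i)
    · simp [h.not_gt, h.ne']
  rw [Finset.prod_congr rfl (fun j _ => hj j), Finset.prod_mul_distrib]
  simp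

theorem cnt_eq (q : ℕ) (m : Fin q → ℕ) (lam : Fin q → ℝ) (hdist : Function.Injective lam)
    (o : Fin (∑ i, m i) ≃ ((i : Fin q) × Fin (m i)))
    (ho : ∀ a b, a < b ↔
      ((o a).1 < (o b).1 ∨ ((o a).1 = (o b).1 ∧ ((o a).2 : ℕ) < (o b).2)))
    (x : ℕ → ℝ) (hx : ∀ a : Fin (∑ i, m i), x a = lam (o a).1) (a : Fin (∑ i, m i)) :
    ((Finset.range a).filter (fun l => lam (o a).1 - x l = 0)).card = ((o a).2 : ℕ) := by
  symm
  rw [← Fintype.card_fin ((o a).2 : ℕ), ← Finset.card_univ]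
  refine Finset.card_bij
    (fun s _ => ((o.symm ⟨(o a).1, ⟨s, s.2.trans (o a).2.2⟩⟩ : Fin _) : ℕ)) ?_ ?_ ?_
  · intro s _
    rw [Finset.mem_filter, Finset.mem_range, hx]
    constructor
    · have : o.symm ⟨(o a).1, ⟨s, s.2.trans (o a).2.2⟩⟩ < a := by
        rw [ho, Equiv.apply_symm_apply]; right; exact ⟨rfl, s.2⟩
      exact this
    · simp
  · intro s _ t _ h
    have h2 := o.symm.injective (Fin.ext h)
    simpa [Fin.ext_iff] using h2
  · intro l hl
    rw [Finset.mem_filter, Finset.mem_range] at hl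
    obtain ⟨hla, hl2⟩ := hl
    have hln : l < ∑ i, m i := hla.trans a.2
    have h3 : (o ⟨l, hln⟩).1 = (o a).1 := by
      apply hdist
      have := hx ⟨l, hln⟩
      simp only at this
      linarith
    have h4 : (⟨l, hln⟩ : Fin (∑ i, m i)) < a := hla
    rw [ho] at h4
    have h5 : ((o ⟨l, hln⟩).2 : ℕ) < (o a).2 := by
      rcases h4 with h4 | h4
      · rw [h3] at h4; exact absurd h4 (lt_irrefl _)
      · exact h4.2
    refine ⟨⟨_, h5⟩, Finset.mem_univ _, ?_⟩
    have h6 : o.symm ⟨(o a).1, ⟨(o ⟨l, hln⟩).2, h5.trans (o a).2.2⟩⟩ = ⟨l, hln⟩ := by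
      rw [Equiv.symm_apply_eq]
      refine Sigma.ext h3.symm ?_
      rw [Fin.heq_ext_iff (by simp [h3])]
    simp only [h6]

theorem cnt_gt (q : ℕ) (m : Fin q → ℕ) (lam : Fin q → ℝ) (hdist : Function.Injective lam)
    (o : Fin (∑ i, m i) ≃ ((i : Fin q) × Fin (m i)))
    (ho : ∀ a b, a < b ↔
      ((o a).1 < (o b).1 ∨ ((o a).1 = (o b).1 ∧ ((o a).2 : ℕ) < (o b).2)))
    (x : ℕ → ℝ) (hx : ∀ a : Fin (∑ i, m i), x a = lam (o a).1) (a : Fin (∑ i, m i))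
    (j : ℕ) (hj : (a : ℕ) < j) :
    ((o a).2 : ℕ) + 1 ≤ ((Finset.range j).filter (fun l => lam (o a).1 - x l = 0)).card := by
  have h := cnt_eq q m lam hdist o ho x hx a
  have h2 : ((Finset.range (a+1)).filter (fun l => lam (o a).1 - x l = 0)).card
      = ((o a).2 : ℕ) + 1 := by
    rw [Finset.range_add_one, Finset.filter_insert, if_pos (by rw [hx]; ring),
      Finset.card_insert_of_notMem (by simp), h]
  rw [← h2]
  refine Finset.card_le_card (Finset.filter_subset_filter _ ?_)
  intro l; simp; omega

/-- The successive shifted images of `b`. -/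
noncomputable def cseq {ι : Type*} [Fintype ι] (A : Matrix ι ι ℝ) (b : ι → ℝ) (x : ℕ → ℝ) :
    ℕ → ι → ℝ
  | 0 => b
  | j+1 => A.mulVec (cseq A b x j) - x j • cseq A b x j

theorem jordan_mulVec (q : ℕ) (m : Fin q → ℕ) (lam : Fin q → ℝ)
    (A : Matrix ((i : Fin q) × Fin (m i)) ((i : Fin q) × Fin (m i)) ℝ)
    (hA : ∀ p p' : (i : Fin q) × Fin (m i), A p p' =
      if p.1 = p'.1 then
        (if (p.2 : ℕ) = (p'.2 : ℕ) then lam p.1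
         else if (p'.2 : ℕ) = (p.2 : ℕ) + 1 then 1 else 0)
      else 0)
    (w : (i : Fin q) × Fin (m i) → ℝ) (i : Fin q) (r : Fin (m i)) :
    A.mulVec w ⟨i, r⟩ = lam i * w ⟨i, r⟩ +
      if h : (r : ℕ) + 1 < m i then w ⟨i, ⟨r + 1, h⟩⟩ else 0 := by
  rw [Matrix.mulVec, dotProduct, Fintype.sum_sigma, Finset.sum_eq_single i]
  · have : ∀ s : Fin (m i), A ⟨i, r⟩ ⟨i, s⟩ * w ⟨i, s⟩ =
        (if s = r then lam i * w ⟨i, s⟩ else 0) +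
        (if (s : ℕ) = r + 1 then w ⟨i, s⟩ else 0) := by
      intro s
      rw [hA]
      by_cases h : s = r
      · subst h; simp
      · have h' : ¬ ((r : ℕ) = s) := fun h2 => h (Fin.ext h2.symm)
        by_cases h3 : (s : ℕ) = r + 1 <;> simp [h, h', h3]
    rw [Finset.sum_congr rfl (fun s _ => this s), Finset.sum_add_distrib]
    congr 1
    · simp
    · split_ifs with h
      · rw [Finset.sum_eq_single ⟨r+1, h⟩]
        · simp
        · intro s _ hs
          rw [if_neg]
          intro h2; exact hs (Fin.ext h2)
        · simp
      · refine Finset.sum_eq_zero fun s _ => ?_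
        rw [if_neg]; have := s.2; omega
  · intro j _ hj
    refine Finset.sum_eq_zero fun s _ => ?_
    rw [hA]; simp [hj.symm]
  · simp

theorem cseq_block (q : ℕ) (m : Fin q → ℕ) (hm : ∀ i, 1 ≤ m i) (lam : Fin q → ℝ)
    (A : Matrix ((i : Fin q) × Fin (m i)) ((i : Fin q) × Fin (m i)) ℝ)
    (hA : ∀ p p' : (i : Fin q) × Fin (m i), A p p' =
      if p.1 = p'.1 then
        (if (p.2 : ℕ) = (p'.2 : ℕ) then lam p.1
         else if (p'.2 : ℕ) = (p.2 : ℕ) + 1 then 1 else 0)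
      else 0)
    (b : (i : Fin q) × Fin (m i) → ℝ) (x : ℕ → ℝ) (i : Fin q) (r : Fin (m i)) (j : ℕ) :
    (m i ≤ r + ((Finset.range j).filter (fun l => lam i - x l = 0)).card →
      cseq A b x j ⟨i, r⟩ = 0) ∧
    (r + ((Finset.range j).filter (fun l => lam i - x l = 0)).card + 1 = m i →
      cseq A b x j ⟨i, r⟩ = b ⟨i, ⟨m i - 1, Nat.sub_lt (hm i) Nat.one_pos⟩⟩ *
        ∏ l ∈ Finset.range j, if lam i - x l = 0 then 1 else (lam i - x l)) := by
  have hm' : m i - 1 < m i := Nat.sub_lt (hm i) Nat.one_pos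
  have := block_rec (fun l => lam i - x l) (m i)
    (fun j r => if h : r < m i then cseq A b x j ⟨i, ⟨r, h⟩⟩ else 0)
    (fun r hr => by simp [hr.not_gt])
    (fun j r => by
      by_cases h : r < m i
      · simp only [h, dif_pos]
        rw [cseq]
        simp only [Pi.sub_apply, Pi.smul_apply, smul_eq_mul]
        rw [jordan_mulVec q m lam A hA]
        simp only
        ring
      · have h2 : ¬ (r + 1 < m i) := by omega
        simp [h, h2]) j
  obtain ⟨h1, h2⟩ := this
  refine ⟨fun h => ?_, fun h => ?_⟩
  · simpa using h1 r h
  · have := h2 r h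
    simp only [r.2, dif_pos, hm'] at this
    exact this

theorem volume_reindex {n : ℕ} {ι : Type*} [Fintype ι] (e : Fin n ≃ ι) (v : ℕ → ι → ℝ) :
    volume {x : ι → ℝ | ∃ u : ℕ → ℝ, (∀ k, |u k| ≤ 1) ∧ HasSum (fun k => u k • v k) x} =
    volume {x : Fin n → ℝ | ∃ u : ℕ → ℝ, (∀ k, |u k| ≤ 1) ∧
      HasSum (fun k => u k • (fun a => v k (e a))) x} := by
  have hp := volume_preserving_arrowCongr' (β₁ := ℝ) (β₂ := ℝ) e.symm (MeasurableEquiv.refl ℝ)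
    (MeasurePreserving.id volume)
  rw [← hp.measure_preimage_equiv]
  congr 1
  ext x
  have hf : (MeasurableEquiv.arrowCongr' e.symm (MeasurableEquiv.refl ℝ)) x = fun a => x (e a) := by
    rfl
  rw [Set.mem_preimage, hf]
  show (∃ u : ℕ → ℝ, _ ∧ _) ↔ (∃ u : ℕ → ℝ, _ ∧ _)
  refine exists_congr fun u => and_congr Iff.rfl ?_
  rw [Pi.hasSum, Pi.hasSum]
  simp only [Pi.smul_apply]
  constructor
  · intro h1 a; exact h1 (e a)
  · intro h1 i; simpa using h1 (e.symm i)

theorem prod_enum (q : ℕ) (m : Fin q → ℕ) (o : Fin (∑ i, m i) ≃ ((i : Fin q) × Fin (m i)))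
    (f : Fin q → ℝ) : ∏ a, f (o a).1 = ∏ i, f i ^ m i := by
  rw [Equiv.prod_comp o (fun p => f p.1), Fintype.prod_sigma]
  simp

theorem exists_bound (q : ℕ) (lam : Fin q → ℝ) (h : ∀ i, 0 ≤ lam i ∧ lam i < 1) :
    ∃ r, 0 ≤ r ∧ r < 1 ∧ ∀ i, lam i ≤ r := by
  rcases isEmpty_or_nonempty (Fin q) with he | he
  · exact ⟨0, le_rfl, one_pos, fun i => (he.false i).elim⟩
  · obtain ⟨i, hi⟩ := Finite.exists_max lam
    exact ⟨lam i, (h i).1, (h i).2, hi⟩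

theorem final_formula (q : ℕ) (m : Fin q → ℕ) (lam : Fin q → ℝ)
    (hlam : ∀ i, 0 ≤ lam i ∧ lam i < 1) (β : Fin q → ℝ)
    (o : Fin (∑ i, m i) ≃ ((i : Fin q) × Fin (m i)))
    (ho : ∀ a b, a < b ↔
      ((o a).1 < (o b).1 ∨ ((o a).1 = (o b).1 ∧ ((o a).2 : ℕ) < (o b).2)))
    (x : ℕ → ℝ) (hx : ∀ a : Fin (∑ i, m i), x a = lam (o a).1) :
    ((∏ a, |β (o a).1|) * pairProd (fun l a =>
      if (o l).1 = (o a).1 then 1 else |lam (o a).1 - lam (o l).1|)) * kform x (∑ i, m i) =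
    |∏ i : Fin q, ∏ j : Fin q,
        if i < j then ((lam i - lam j) / (1 - lam i * lam j)) ^ (m i * m j) else 1| *
      ∏ i : Fin q, |β i| ^ (m i) /
        ((1 - lam i) ^ (m i) * (1 - lam i ^ 2) ^ (m i * (m i - 1) / 2)) := by
  have h1 : kform x (∑ i, m i) = pairProd (fun l a => (1 - lam (o l).1 * lam (o a).1)⁻¹) *
      ∏ a, (1 - lam (o a).1)⁻¹ := by
    unfold kform; simp only [hx]
  rw [h1]
  have h2 := pairs_lex q m (fun i j => (if i = j then 1 else |lam j - lam i|) *
    (1 - lam i * lam j)⁻¹) o ho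
  rw [pairProd_mul] at h2
  have h3 := prod_enum q m o (fun i => |β i|)
  have h4 := prod_enum q m o (fun i => (1 - lam i)⁻¹)
  rw [h3, h4]
  rw [show ∀ a b c d : ℝ, a * b * (c * d) = (b * c) * (a * d) by intros; ring, h2]
  have h5 : (∏ i : Fin q, ∏ j : Fin q, if i < j then
      ((if i = j then 1 else |lam j - lam i|) * (1 - lam i * lam j)⁻¹) ^ (m i * m j) else 1) =
      |∏ i : Fin q, ∏ j : Fin q,
        if i < j then ((lam i - lam j) / (1 - lam i * lam j)) ^ (m i * m j) else 1| := by
    rw [Finset.abs_prod]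
    refine Finset.prod_congr rfl fun i _ => ?_
    rw [Finset.abs_prod]
    refine Finset.prod_congr rfl fun j _ => ?_
    split_ifs with h h'
    · exact absurd h' h.ne
    · have : 0 < 1 - lam i * lam j := by
        nlinarith [hlam i, hlam j, mul_le_mul (hlam i).2.le (hlam j).2.le (hlam j).1 zero_le_one]
      rw [abs_pow, abs_div, abs_of_pos this, abs_sub_comm, div_eq_mul_inv]
    · simp
  rw [h5, mul_assoc]
  congr 1
  rw [← Finset.prod_mul_distrib, ← Finset.prod_mul_distrib]
  refine Finset.prod_congr rfl fun i _ => ?_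
  rw [if_pos rfl, one_mul, div_eq_mul_inv, mul_inv, inv_pow, inv_pow, ← pow_two]
  ring

theorem stmt_core (q : ℕ) (m : Fin q → ℕ) (hm : ∀ i, 1 ≤ m i)
    (lam : Fin q → ℝ) (hlam : ∀ i, 0 ≤ lam i ∧ lam i < 1)
    (hdist : Function.Injective lam)
    (A : Matrix ((i : Fin q) × Fin (m i)) ((i : Fin q) × Fin (m i)) ℝ)
    (hA : ∀ p p' : (i : Fin q) × Fin (m i), A p p' =
      if p.1 = p'.1 then
        (if (p.2 : ℕ) = (p'.2 : ℕ) then lam p.1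
         else if (p'.2 : ℕ) = (p.2 : ℕ) + 1 then 1 else 0)
      else 0)
    (b : (i : Fin q) × Fin (m i) → ℝ)
    (o : Fin (∑ i, m i) ≃ ((i : Fin q) × Fin (m i)))
    (ho : ∀ a b, a < b ↔
      ((o a).1 < (o b).1 ∨ ((o a).1 = (o b).1 ∧ ((o a).2 : ℕ) < (o b).2)))
    (x : ℕ → ℝ) (hx : ∀ a : Fin (∑ i, m i), x a = lam (o a).1) :
    ∃ e : Fin (∑ i, m i) ≃ ((i : Fin q) × Fin (m i)), ∃ D : ℝ,
      |D| = (∏ a, |b ⟨(o a).1, ⟨m (o a).1 - 1, Nat.sub_lt (hm (o a).1) Nat.one_pos⟩⟩|) *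
        pairProd (fun l a => if (o l).1 = (o a).1 then 1 else |lam (o a).1 - lam (o l).1|) ∧
      ∀ k : Fin (∑ i, m i) → ℕ,
        Matrix.det (Matrix.of fun a c => ((A ^ (k a)).mulVec b) (e c)) =
          D * kdet x (∑ i, m i) k := by
  let e : Fin (∑ i, m i) ≃ ((i : Fin q) × Fin (m i)) :=
    o.trans (Equiv.sigmaCongrRight fun i => Fin.revPerm)
  have he : ∀ a, e a = ⟨(o a).1, Fin.rev (o a).2⟩ := fun a => rfl
  let N : Matrix (Fin (∑ i, m i)) (Fin (∑ i, m i)) ℝ := Matrix.of fun j a => cseq A b x j (e a)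
  have hup : N.IsUpperTriangular := by
    intro j a haj
    have haj' : a < j := haj
    show cseq A b x j (e a) = 0
    rw [he]
    apply (cseq_block q m hm lam A hA b x _ _ j).1
    have := cnt_gt q m lam hdist o ho x hx a j haj'
    have h2 := (o a).2.2
    rw [Fin.val_rev]
    omega
  have hcn : cseq A b x (∑ i, m i) = 0 := by
    funext p
    obtain ⟨i, r⟩ := p
    apply (cseq_block q m hm lam A hA b x _ _ (∑ i, m i)).1
    have hmi := hm i
    have := cnt_gt q m lam hdist o ho x hx (o.symm ⟨i, ⟨m i - 1, Nat.sub_lt (hm i) Nat.one_pos⟩⟩) (∑ i, m i) (Fin.is_lt _)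
    rw [Equiv.apply_symm_apply] at this
    simp only at this
    omega
  refine ⟨e, N.det, ?_, ?_⟩
  · rw [Matrix.det_of_isUpperTriangular hup, Finset.abs_prod]
    unfold pairProd
    rw [Finset.prod_comm, ← Finset.prod_mul_distrib]
    refine Finset.prod_congr rfl fun a _ => ?_
    have hNaa : N a a = b ⟨(o a).1, ⟨m (o a).1 - 1, Nat.sub_lt (hm (o a).1) Nat.one_pos⟩⟩ *
        ∏ l ∈ Finset.range a, if lam (o a).1 - x l = 0 then 1 else (lam (o a).1 - x l) := by
      show cseq A b x a (e a) = _
      rw [he]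
      apply (cseq_block q m hm lam A hA b x _ _ a).2
      rw [cnt_eq q m lam hdist o ho x hx a, Fin.val_rev]
      have h2 := (o a).2.2
      omega
    rw [hNaa, abs_mul, Finset.abs_prod]
    congr 1
    have h3 : (Finset.range (∑ i, m i)).filter (fun l => l < (a : ℕ)) = Finset.range a := by
      ext l; have := a.2; simp; omega
    rw [← h3, Finset.prod_filter, ← Fin.prod_univ_eq_prod_range
      (fun l => if l < (a : ℕ) then |if lam (o a).1 - x l = 0 then 1 else lam (o a).1 - x l| else 1)]
    refine Finset.prod_congr rfl fun l _ => ?_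
    rw [hx]
    by_cases hla : l < a
    · have : (l : ℕ) < a := hla
      rw [if_pos this, if_pos hla]
      by_cases h : (o l).1 = (o a).1
      · simp [h]
      · have : lam (o a).1 - lam (o l).1 ≠ 0 := by
          intro h2; exact h (hdist (by linarith))
        rw [if_neg this]; exact (if_neg h).symm
    · have : ¬ (l : ℕ) < a := hla
      rw [if_neg this, if_neg hla]
  · intro k
    have hmul : (Matrix.of fun a c => ((A ^ (k a)).mulVec b) (e c)) =
        (Matrix.of fun a j : Fin (∑ i, m i) => krylov x (k a) j) * N := by
      ext a c
      have hex := krylov_expand x A.mulVecLin (cseq A b x) (∑ i, m i)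
        (fun j => by rw [cseq]; simp) hcn (k a)
      have hpow : (A.mulVecLin ^ (k a)) (cseq A b x 0) = (A ^ (k a)).mulVec b := by
        rw [← Matrix.toLin'_apply', ← Matrix.toLin'_pow, Matrix.toLin'_apply]; rfl
      rw [hpow] at hex
      rw [Matrix.mul_apply, Matrix.of_apply, hex, Finset.sum_apply,
        ← Fin.sum_univ_eq_sum_range (fun j => (krylov x (k a) j • cseq A b x j) (e c))]
      rfl
    rw [hmul, Matrix.det_mul, mul_comm]
    rfl

/-- For a block-diagonal Jordan matrix `A` with `q` Jordan blocks of
sizes `mᵢ` and distinct eigenvalues `λᵢ ∈ [0,1)`, and `b` with block components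
`βᵢ` having last entries `b_{i,mᵢ}`, the volume of the infinite-horizon reachable
zonotope equals
`2ⁿ · |∏_{i<j} ((λᵢ-λⱼ)/(1-λᵢλⱼ))^{mᵢmⱼ}| · ∏ᵢ |b_{i,mᵢ}|^{mᵢ} / ((1-λᵢ)^{mᵢ}(1-λᵢ²)^{mᵢ(mᵢ-1)/2})`,
where `n = ∑ mᵢ`. The state space is indexed by `Σ i : Fin q, Fin (m i)`. -/
theorem stmt10 (q : ℕ) (m : Fin q → ℕ) (hm : ∀ i, 1 ≤ m i)
    (lam : Fin q → ℝ) (hlam : ∀ i, 0 ≤ lam i ∧ lam i < 1)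
    (hdist : Function.Injective lam)
    (A : Matrix ((i : Fin q) × Fin (m i)) ((i : Fin q) × Fin (m i)) ℝ)
    (hA : ∀ p p' : (i : Fin q) × Fin (m i), A p p' =
      if p.1 = p'.1 then
        (if (p.2 : ℕ) = (p'.2 : ℕ) then lam p.1
         else if (p'.2 : ℕ) = (p.2 : ℕ) + 1 then 1 else 0)
      else 0)
    (b : (i : Fin q) × Fin (m i) → ℝ) :
    volume {x : (i : Fin q) × Fin (m i) → ℝ | ∃ u : ℕ → ℝ, (∀ k, |u k| ≤ 1) ∧
        HasSum (fun k : ℕ => u k • (A ^ k).mulVec b) x} =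
    ENNReal.ofReal ((2 : ℝ) ^ (∑ i : Fin q, m i) *
      |∏ i : Fin q, ∏ j : Fin q,
        if i < j then ((lam i - lam j) / (1 - lam i * lam j)) ^ (m i * m j) else 1| *
      ∏ i : Fin q, |b ⟨i, ⟨m i - 1, by have := hm i; omega⟩⟩| ^ (m i) /
        ((1 - lam i) ^ (m i) * (1 - lam i ^ 2) ^ (m i * (m i - 1) / 2))) := by
  obtain ⟨o, ho⟩ := exists_enum q m
  obtain ⟨r, hr0, hr1, hr⟩ := exists_bound q lam hlam
  let x : ℕ → ℝ := fun j => if h : j < ∑ i, m i then lam (o ⟨j, h⟩).1 else 0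
  have hx : ∀ a : Fin (∑ i, m i), x a = lam (o a).1 := fun a => by simp [x]
  have hx0 : ∀ j, 0 ≤ x j := by
    intro j; simp only [x]; split_ifs
    · exact (hlam _).1
    · exact le_rfl
  have hx1 : ∀ j, x j ≤ r := by
    intro j; simp only [x]; split_ifs
    · exact hr _
    · exact hr0
  obtain ⟨e, D, hD, hdet⟩ := stmt_core q m hm lam hlam hdist A hA b o ho x hx
  have hlim := (kdet_tendsto x (∑ i, m i) r hr1 hx0 hx1).const_mul |D|
  have hfun : (fun N => incSum (∑ i, m i) N (fun k => |Matrix.det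
      (Matrix.of fun a => (fun c => ((A ^ (k a)).mulVec b) (e c)))|)) =
      fun N => |D| * incSum (∑ i, m i) N (kdet x (∑ i, m i)) := by
    funext N
    rw [← incSum_mul]
    refine incSum_congr N _ _ _ fun k hk => ?_
    have := hdet k
    rw [this, abs_mul, abs_of_nonneg (kdet_nonneg _ x hx0 k hk)]
  rw [← hfun] at hlim
  rw [volume_reindex e (fun k => (A ^ k).mulVec b),
    volume_reach (fun k c => ((A ^ k).mulVec b) (e c)) _ hlim, hD,
    final_formula q m lam hlam
      (fun i => b ⟨i, ⟨m i - 1, Nat.sub_lt (hm i) Nat.one_pos⟩⟩) o ho x hx, ← mul_assoc]
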